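/- Let p be a fixed prime. Suppose that (QIA_p) holds. Let S ⊆ ℕ be a set for which there exists N ∈ ℕ such that p^{N+1} does not divide any n ∈ S. Then for every non-negative function ψ : ℕ → ℝ with ψ(n) = 0 for all n ∉ S and with Σ_{n∈ℕ} λ(A_n(ψ)) = ∞, one has λ(W_∞(ψ)) = 1. -/

import Mathlib

open MeasureTheory Filter

noncomputable section

/-- The set `E_n(ψ) ⊆ ℤ_p`: union over integers `a` with `|a| ≤ n`, `gcd(a,n) = 1`
of the closed balls `{x : |x - a/n|_p ≤ ψ(n)}`. -/
def padicE (p : ℕ) [Fact p.Prime] (ψ : ℕ → ℝ) (n : ℕ) : Set ℤ_[p] :=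
  {x | ∃ a : ℤ, |a| ≤ (n : ℤ) ∧ Int.gcd a n = 1 ∧
    ‖(x : ℚ_[p]) - (a : ℚ_[p]) / (n : ℚ_[p])‖ ≤ ψ n}

/-- The set `A_n(ψ) ⊆ ℝ/ℤ`: union over `1 ≤ a ≤ n`, `gcd(a,n) = 1` of the closed
intervals `[a/n - ψ(n), a/n + ψ(n)]` taken mod 1. -/
def circleA (ψ : ℕ → ℝ) (n : ℕ) : Set UnitAddCircle :=
  {x | ∃ a : ℕ, 1 ≤ a ∧ a ≤ n ∧ Nat.gcd a n = 1 ∧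
    ‖x - (((a : ℝ) / (n : ℝ) : ℝ) : UnitAddCircle)‖ ≤ ψ n}

/-- `W_∞(ψ)`: the points of `ℝ/ℤ` lying in infinitely many of the sets `A_n(ψ)`. -/
def circleW (ψ : ℕ → ℝ) : Set UnitAddCircle :=
  {x | {n : ℕ | x ∈ circleA ψ n}.Infinite}

/-- `(QIA_p)` holds for the Haar probability measure `μ` on `ℤ_p`: quasi-independence
on average holds for every non-negative `ψ` with divergent sum of measures. -/
def QIApHolds (p : ℕ) [Fact p.Prime] [MeasurableSpace ℤ_[p]] (μ : Measure ℤ_[p]) : Prop :=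
  ∀ ψ : ℕ → ℝ, (∀ n, 0 ≤ ψ n) → (∑' n : ℕ, μ (padicE p ψ n)) = ⊤ →
    0 < atTop.limsup (fun N : ℕ =>
      (∑ n ∈ Finset.Icc 1 N, μ (padicE p ψ n)) ^ 2 /
        ∑ m ∈ Finset.Icc 1 N, ∑ n ∈ Finset.Icc 1 N, μ (padicE p ψ m ∩ padicE p ψ n))

/-- The proportion `φ(n)/n` of residues that are coprime to `n`, as an Euler product. -/
def coprimeDensity (n : ℕ) : ℝ := ∏ q ∈ n.primeFactors, (1 - (q : ℝ)⁻¹)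

theorem one_sub_inv_prime_pos {q : ℕ} (hq : q.Prime) : 0 < 1 - (q : ℝ)⁻¹ := by
  have : (1 : ℝ) < q := by exact_mod_cast hq.one_lt
  have := inv_lt_one_of_one_lt₀ this
  linarith

theorem one_sub_inv_natCast_le_one (q : ℕ) : 1 - (q : ℝ)⁻¹ ≤ 1 := by
  have : (0 : ℝ) ≤ (q : ℝ)⁻¹ := by positivity
  linarith

theorem coprimeDensity_pos (n : ℕ) : 0 < coprimeDensity n :=
  Finset.prod_pos fun _ hq => one_sub_inv_prime_pos (Nat.prime_of_mem_primeFactors hq)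

theorem totient_eq_mul_coprimeDensity (n : ℕ) : (n.totient : ℝ) = n * coprimeDensity n := by
  have h := congrArg (Rat.cast : ℚ → ℝ) (Nat.totient_eq_mul_prod_factors n)
  push_cast at h
  exact h

theorem card_primeFactors_pow_le (t : ℕ) (ht : t ≠ 0) :
    256 ^ t.primeFactors.card ≤ 256 ^ 256 * t := by
  calc 256 ^ t.primeFactors.card = ∏ _q ∈ t.primeFactors, 256 := by simp
    _ ≤ ∏ q ∈ t.primeFactors, (if q < 256 then 256 else 1) * q := by
        refine Finset.prod_le_prod' fun q hq => ?_
        have := (Nat.prime_of_mem_primeFactors hq).pos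
        split_ifs <;> omega
    _ = 256 ^ (t.primeFactors.filter (· < 256)).card * ∏ q ∈ t.primeFactors, q := by
        rw [Finset.prod_mul_distrib, ← Finset.prod_filter, Finset.prod_const]
    _ ≤ 256 ^ 256 * t := by
        refine Nat.mul_le_mul (Nat.pow_le_pow_right (by norm_num) ?_)
          (Nat.le_of_dvd (Nat.pos_of_ne_zero ht) (Nat.prod_primeFactors_dvd t))
        refine (Finset.card_le_card (t := Finset.range 256) fun q hq => ?_).trans (by simp)
        simpa using (Finset.mem_filter.1 hq).2

theorem exists_four_pow_card_primeFactors_le :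
    ∃ C : ℝ, 0 < C ∧ ∀ t : ℕ, t ≠ 0 → (4 : ℝ) ^ t.primeFactors.card ≤ C * (t : ℝ) ^ (1 / 4 : ℝ) := by
  refine ⟨((256 : ℝ) ^ 256) ^ (1 / 4 : ℝ), Real.rpow_pos_of_pos (pow_pos (by norm_num) _) _, fun t ht => ?_⟩
  have h : ((256 : ℝ)) ^ t.primeFactors.card ≤ 256 ^ 256 * t := by
    exact_mod_cast card_primeFactors_pow_le t ht
  rw [← Real.mul_rpow (pow_nonneg (by norm_num) _) (by positivity)]
  have h4 : ((4 : ℝ) ^ t.primeFactors.card) = ((256 : ℝ) ^ t.primeFactors.card) ^ (1 / 4 : ℝ) := by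
    rw [show (256 : ℝ) = 4 ^ 4 by norm_num, ← pow_mul, mul_comm 4, pow_mul,
      ← Real.rpow_natCast (_ ^ _) 4, ← Real.rpow_mul (by positivity)]
    norm_num
  rw [h4]
  exact Real.rpow_le_rpow (by positivity) h (by norm_num)

theorem inv_two_pow_le_coprimeDensity (n : ℕ) :
    ((2 : ℝ) ^ n.primeFactors.card)⁻¹ ≤ coprimeDensity n := by
  rw [← inv_pow, ← Finset.prod_const]
  refine Finset.prod_le_prod (fun _ _ => by norm_num) fun q hq => ?_
  have : (2 : ℝ) ≤ q := by exact_mod_cast (Nat.prime_of_mem_primeFactors hq).two_le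
  have := inv_anti₀ (by norm_num) this
  linarith

theorem two_pow_card_primeFactors_le (n : ℕ) :
    (2 : ℝ) ^ n.primeFactors.card ≤ (4 : ℝ) ^ n.primeFactors.card * coprimeDensity n := by
  have h := inv_two_pow_le_coprimeDensity n
  calc (2 : ℝ) ^ n.primeFactors.card
      = 4 ^ n.primeFactors.card * (2 ^ n.primeFactors.card)⁻¹ := by
        rw [show (4 : ℝ) = 2 * 2 by norm_num, mul_pow]; field_simp
    _ ≤ _ := by gcongr

theorem exists_inv_totient_le :
    ∃ C : ℝ, 0 < C ∧ ∀ d : ℕ, d ≠ 0 → ((d.totient : ℝ))⁻¹ ≤ C * (d : ℝ) ^ (-(3 / 4) : ℝ) := by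
  obtain ⟨C, hC, h⟩ := exists_four_pow_card_primeFactors_le
  refine ⟨C, hC, fun d hd => ?_⟩
  have hd0 : (0 : ℝ) < d := by exact_mod_cast Nat.pos_of_ne_zero hd
  have h1 := inv_two_pow_le_coprimeDensity d
  have h2 : (2 : ℝ) ^ d.primeFactors.card ≤ C * (d : ℝ) ^ (1 / 4 : ℝ) :=
    (pow_le_pow_left₀ (by norm_num) (by norm_num) _).trans (h d hd)
  rw [totient_eq_mul_coprimeDensity, mul_inv]
  have h3 : (coprimeDensity d)⁻¹ ≤ 2 ^ d.primeFactors.card :=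
    inv_le_of_inv_le₀ (by positivity) h1
  calc (d : ℝ)⁻¹ * (coprimeDensity d)⁻¹ ≤ (d : ℝ)⁻¹ * (C * (d : ℝ) ^ (1 / 4 : ℝ)) := by
        gcongr; exact h3.trans h2
    _ = C * (d : ℝ) ^ (-(3 / 4) : ℝ) := by
        rw [← Real.rpow_neg_one, mul_left_comm, ← Real.rpow_add hd0]; norm_num

theorem tendsto_totient_atTop : Tendsto (fun n : ℕ => (n.totient : ℝ)) atTop atTop := by
  obtain ⟨C, hC, h⟩ := exists_inv_totient_le
  have h1 : Tendsto (fun n : ℕ => C⁻¹ * (n : ℝ) ^ (3 / 4 : ℝ)) atTop atTop :=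
    ((tendsto_rpow_atTop (by norm_num : (0 : ℝ) < 3 / 4)).comp
      tendsto_natCast_atTop_atTop).const_mul_atTop (by positivity)
  refine tendsto_atTop_mono' _ ?_ h1
  filter_upwards [eventually_ne_atTop 0] with n hn
  have hn0 : (0 : ℝ) < n := by exact_mod_cast Nat.pos_of_ne_zero hn
  have ht : (0 : ℝ) < n.totient := by exact_mod_cast Nat.totient_pos.2 (Nat.pos_of_ne_zero hn)
  have := inv_le_of_inv_le₀ ht (h n hn)
  rwa [mul_inv, ← Real.rpow_neg hn0.le, neg_neg] at this

/-- The Legendre sieve. -/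
theorem abs_card_coprime_sub_le (P : Finset ℕ) (hP : ∀ q ∈ P, q.Prime) (y : ℝ) (hy : 0 ≤ y) :
    |(((Finset.Icc 1 ⌊y⌋₊).filter fun e => ∀ q ∈ P, ¬ q ∣ e).card : ℝ)
      - y * ∏ q ∈ P, (1 - (q : ℝ)⁻¹)| ≤ 2 ^ P.card := by
  classical
  induction P using Finset.induction_on generalizing y with
  | empty =>
    have h1 := Nat.floor_le hy
    have h2 := Nat.lt_floor_add_one y
    simp only [Finset.notMem_empty, false_imp_iff, implies_true, Finset.filter_true,
      Nat.card_Icc, Finset.prod_empty, Finset.card_empty, pow_zero, add_tsub_cancel_right]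
    rw [abs_le]; constructor <;> linarith
  | insert q P hq ih =>
    have hqp : q.Prime := hP q (Finset.mem_insert_self _ _)
    have hP' : ∀ r ∈ P, r.Prime := fun r hr => hP r (Finset.mem_insert_of_mem hr)
    have i1 := ih hP' y hy
    have i2 := ih hP' (y / q) (by positivity)
    have key : ((Finset.Icc 1 ⌊y⌋₊).filter fun e => ∀ r ∈ P, ¬ r ∣ e).card
        = ((Finset.Icc 1 ⌊y⌋₊).filter fun e => ∀ r ∈ insert q P, ¬ r ∣ e).card
          + ((Finset.Icc 1 ⌊y / q⌋₊).filter fun e => ∀ r ∈ P, ¬ r ∣ e).card := by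
      rw [← Finset.card_filter_add_card_filter_not (s := (Finset.Icc 1 ⌊y⌋₊).filter
        fun e => ∀ r ∈ P, ¬ r ∣ e) (fun e => ¬ q ∣ e), Finset.filter_filter, Finset.filter_filter]
      congr 1
      · congr 1
        ext e
        simp only [Finset.mem_filter, Finset.forall_mem_insert]
        tauto
      · rw [Nat.floor_div_natCast]
        symm
        refine Finset.card_bij (fun e _ => q * e) ?_ ?_ ?_
        · intro e he
          simp only [Finset.mem_filter, Finset.mem_Icc] at he ⊢
          obtain ⟨⟨h1, h2⟩, h3⟩ := he
          refine ⟨⟨Nat.mul_pos hqp.pos h1, ?_⟩, fun r hr hd => ?_, by simp⟩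
          · rw [mul_comm]; exact (Nat.le_div_iff_mul_le hqp.pos).1 h2
          · rcases (hP' r hr).dvd_mul.1 hd with h | h
            · rw [(Nat.prime_dvd_prime_iff_eq (hP' r hr) hqp).1 h] at hr
              exact hq hr
            · exact h3 r hr h
        · intro a _ b _ h
          exact Nat.eq_of_mul_eq_mul_left hqp.pos h
        · intro e he
          simp only [Finset.mem_filter, Finset.mem_Icc, not_not] at he
          obtain ⟨⟨h1, h2⟩, h3, ⟨f, rfl⟩⟩ := he
          refine ⟨f, ?_, rfl⟩
          simp only [Finset.mem_filter, Finset.mem_Icc]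
          refine ⟨⟨Nat.pos_of_ne_zero (by rintro rfl; simp at h1), ?_⟩,
            fun r hr hd => h3 r hr (hd.mul_left q)⟩
          rw [Nat.le_div_iff_mul_le hqp.pos, mul_comm]; exact h2
    have key' := congrArg (Nat.cast : ℕ → ℝ) key
    push_cast at key'
    rw [Finset.prod_insert hq, Finset.card_insert_of_notMem hq, pow_succ]
    rw [abs_le] at i1 i2 ⊢
    have e : y / q * ∏ r ∈ P, (1 - (r : ℝ)⁻¹) = y * ∏ r ∈ P, (1 - (r : ℝ)⁻¹)
       - y * ((1 - (q : ℝ)⁻¹) * ∏ r ∈ P, (1 - (r : ℝ)⁻¹)) := by ring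
    rw [e] at i2
    constructor <;> linarith [i1.1, i1.2, i2.1, i2.2]

theorem div_totient_le_sum_divisors (c : ℕ) (hc : c ≠ 0) :
    (coprimeDensity c)⁻¹ ≤ ∑ d ∈ c.divisors, ((d.totient : ℝ))⁻¹ := by
  classical
  have e : (coprimeDensity c)⁻¹ = ∏ q ∈ c.primeFactors, (1 + ((q.totient : ℝ))⁻¹) := by
    rw [coprimeDensity, ← Finset.prod_inv_distrib]
    refine Finset.prod_congr rfl fun q hq => ?_
    have hq := Nat.prime_of_mem_primeFactors hq
    have h1 : (1 : ℝ) < q := by exact_mod_cast hq.one_lt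
    rw [Nat.totient_prime hq, Nat.cast_pred hq.pos]
    have h2 : (q : ℝ) - 1 ≠ 0 := by linarith
    have h3 : (q : ℝ) ≠ 0 := by linarith
    field_simp
    ring
  rw [e, Finset.prod_one_add]
  have hprime : ∀ P ∈ c.primeFactors.powerset, ∀ q ∈ P, q.Prime := fun P hP q hq =>
    Nat.prime_of_mem_primeFactors (Finset.mem_powerset.1 hP hq)
  have htot : ∀ P : Finset ℕ, (∀ q ∈ P, q.Prime) →
      ∏ q ∈ P, ((q.totient : ℝ))⁻¹ = (((∏ q ∈ P, q).totient : ℝ))⁻¹ := by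
    intro P hP
    induction P using Finset.induction_on with
    | empty => simp
    | insert q P hq ih =>
      rw [Finset.prod_insert hq, Finset.prod_insert hq, Nat.totient_mul, Nat.cast_mul, mul_inv,
        ih fun r hr => hP r (Finset.mem_insert_of_mem hr)]
      refine Nat.Coprime.prod_right fun r hr => ?_
      rw [Nat.coprime_primes (hP q (Finset.mem_insert_self _ _)) (hP r (Finset.mem_insert_of_mem hr))]
      rintro rfl; exact hq hr
  calc ∑ P ∈ c.primeFactors.powerset, ∏ q ∈ P, ((q.totient : ℝ))⁻¹
      = ∑ P ∈ c.primeFactors.powerset, (((∏ q ∈ P, q).totient : ℝ))⁻¹ :=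
        Finset.sum_congr rfl fun P hP => htot P (hprime P hP)
    _ = ∑ d ∈ c.primeFactors.powerset.image (fun P => ∏ q ∈ P, q), ((d.totient : ℝ))⁻¹ := by
        rw [Finset.sum_image]
        intro P hP Q hQ h
        have hP' := Nat.primeFactors_prod (hprime P hP)
        have hQ' := Nat.primeFactors_prod (hprime Q hQ)
        simp only at h
        rw [← hP', ← hQ', h]
    _ ≤ _ := by
        refine Finset.sum_le_sum_of_subset_of_nonneg ?_ fun _ _ _ => by positivity
        intro d hd
        obtain ⟨P, hP, rfl⟩ := Finset.mem_image.1 hd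
        refine Nat.mem_divisors.2 ⟨?_, hc⟩
        exact (Finset.prod_dvd_prod_of_subset _ _ _ (Finset.mem_powerset.1 hP)).trans
          (Nat.prod_primeFactors_dvd c)

/-- An upper bound sieve for the integers up to `y` coprime to `t ≤ y ^ 2`, weighted by `c / φ(c)`. -/
theorem exists_sum_inv_coprimeDensity_le :
    ∃ C : ℝ, 0 < C ∧ ∀ t : ℕ, t ≠ 0 → ∀ y : ℝ, 0 ≤ y → (t : ℝ) ≤ y ^ 2 →
      ∑ c ∈ (Finset.Icc 1 ⌊y⌋₊).filter (fun c => ∀ q ∈ t.primeFactors, ¬ q ∣ c),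
        (coprimeDensity c)⁻¹ ≤ C * y * coprimeDensity t := by
  classical
  obtain ⟨A, hA, hA'⟩ := exists_four_pow_card_primeFactors_le
  obtain ⟨B, hB, hB'⟩ := exists_inv_totient_le
  have hs : Summable fun d : ℕ => (d : ℝ) ^ (-(5 / 4) : ℝ) :=
    Real.summable_nat_rpow.2 (by norm_num)
  set Z := ∑' d : ℕ, (d : ℝ) ^ (-(5 / 4) : ℝ)
  have hZ : 0 ≤ Z := tsum_nonneg fun _ => by positivity
  refine ⟨(1 + A) * B * (Z + 1), by positivity, fun t ht y hy hty => ?_⟩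
  set w := coprimeDensity t
  have hw : 0 < w := coprimeDensity_pos t
  set good : ℕ → Prop := fun c => ∀ q ∈ t.primeFactors, ¬ q ∣ c with hgood
  have herr : (2 : ℝ) ^ t.primeFactors.card ≤ A * y ^ (1 / 2 : ℝ) * w := by
    refine (two_pow_card_primeFactors_le t).trans ?_
    gcongr
    refine (hA' t ht).trans ?_
    gcongr
    calc (t : ℝ) ^ (1 / 4 : ℝ) ≤ (y ^ 2) ^ (1 / 4 : ℝ) := by gcongr
      _ = y ^ (1 / 2 : ℝ) := by
        rw [← Real.rpow_natCast, ← Real.rpow_mul hy]; norm_num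
  have hcount : ∀ d : ℕ, d ∈ Finset.Icc 1 ⌊y⌋₊ →
      ((d.totient : ℝ))⁻¹ * (((Finset.Icc 1 ⌊y / d⌋₊).filter good).card : ℝ)
        ≤ (1 + A) * B * y * w * (d : ℝ) ^ (-(5 / 4) : ℝ) := by
    intro d hd
    rw [Finset.mem_Icc] at hd
    have hd0 : (0 : ℝ) < d := by exact_mod_cast hd.1
    have hdy : (d : ℝ) ≤ y := (Nat.le_floor_iff hy).1 hd.2
    have h1 := (abs_le.1 (abs_card_coprime_sub_le t.primeFactors
      (fun _ h => Nat.prime_of_mem_primeFactors h) (y / d) (by positivity))).2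
    have h2 : (((Finset.Icc 1 ⌊y / d⌋₊).filter good).card : ℝ) ≤ y / d * w
        + A * y ^ (1 / 2 : ℝ) * w := by
      have : ∏ q ∈ t.primeFactors, (1 - (q : ℝ)⁻¹) = w := rfl
      rw [this] at h1
      linarith
    have e1 : y / d = y * (d : ℝ) ^ (-(1 / 2) : ℝ) * (d : ℝ) ^ (-(1 / 2) : ℝ) := by
      rw [mul_assoc, ← Real.rpow_add hd0, show (-(1 / 2) : ℝ) + -(1 / 2) = -1 by norm_num,
        Real.rpow_neg_one, div_eq_mul_inv]
    have hd1 : (d : ℝ) ^ (-(1 / 2) : ℝ) ≤ 1 :=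
      Real.rpow_le_one_of_one_le_of_nonpos (by exact_mod_cast hd.1) (by norm_num)
    have h3 : y / d ≤ y * (d : ℝ) ^ (-(1 / 2) : ℝ) := by
      rw [e1]
      exact mul_le_of_le_one_right (by positivity) hd1
    have h4 : y ^ (1 / 2 : ℝ) ≤ y * (d : ℝ) ^ (-(1 / 2) : ℝ) := by
      have hy0 : 0 < y := hd0.trans_le hdy
      calc y ^ (1 / 2 : ℝ) = y * y ^ (-(1 / 2) : ℝ) := by
            nth_rewrite 2 [← Real.rpow_one y]
            rw [← Real.rpow_add hy0]; norm_num
        _ ≤ _ := by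
            gcongr y * ?_
            exact Real.rpow_le_rpow_of_nonpos hd0 hdy (by norm_num)
    calc ((d.totient : ℝ))⁻¹ * (((Finset.Icc 1 ⌊y / d⌋₊).filter good).card : ℝ)
        ≤ (B * (d : ℝ) ^ (-(3 / 4) : ℝ)) * (y * (d : ℝ) ^ (-(1 / 2) : ℝ) * w
            + A * (y * (d : ℝ) ^ (-(1 / 2) : ℝ)) * w) := by
          refine mul_le_mul (hB' d (by omega)) (h2.trans ?_) (by positivity) (by positivity)
          gcongr
      _ = (1 + A) * B * y * w * ((d : ℝ) ^ (-(3 / 4) : ℝ) * (d : ℝ) ^ (-(1 / 2) : ℝ)) := by ring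
      _ = _ := by rw [← Real.rpow_add hd0]; norm_num
  calc ∑ c ∈ (Finset.Icc 1 ⌊y⌋₊).filter good, (coprimeDensity c)⁻¹
      ≤ ∑ c ∈ (Finset.Icc 1 ⌊y⌋₊).filter good, ∑ d ∈ c.divisors, ((d.totient : ℝ))⁻¹ := by
        refine Finset.sum_le_sum fun c hc => div_totient_le_sum_divisors c ?_
        have := (Finset.mem_Icc.1 (Finset.mem_filter.1 hc).1).1
        omega
    _ = ∑ x ∈ ((Finset.Icc 1 ⌊y⌋₊).filter good).sigma fun c => c.divisors,
          ((x.2.totient : ℝ))⁻¹ := by rw [Finset.sum_sigma]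
    _ ≤ ∑ x ∈ (Finset.Icc 1 ⌊y⌋₊).sigma fun d => (Finset.Icc 1 ⌊y / d⌋₊).filter good,
          ((x.1.totient : ℝ))⁻¹ := by
        have hinj : Set.InjOn (fun x : (_ : ℕ) × ℕ => (⟨x.2, x.1 / x.2⟩ : (_ : ℕ) × ℕ))
            (((Finset.Icc 1 ⌊y⌋₊).filter good).sigma fun c => c.divisors) := by
          rintro ⟨c, d⟩ hc ⟨c', d'⟩ hc' h
          simp only [Sigma.mk.injEq, heq_eq_eq] at h
          obtain ⟨rfl, h⟩ := h
          simp only [Finset.coe_sigma, Set.mem_sigma_iff, Finset.mem_coe,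
            Nat.mem_divisors] at hc hc'
          simp only [Sigma.mk.injEq, heq_eq_eq, and_true]
          rw [← Nat.div_mul_cancel hc.2.1, h, Nat.div_mul_cancel hc'.2.1]
        rw [← Finset.sum_image (f := fun x : (_ : ℕ) × ℕ => ((x.1.totient : ℝ))⁻¹) hinj]
        refine Finset.sum_le_sum_of_subset_of_nonneg ?_ fun _ _ _ => by positivity
        intro x hx
        obtain ⟨⟨c, d⟩, hc, rfl⟩ := Finset.mem_image.1 hx
        simp only [Finset.mem_sigma, Finset.mem_filter, Finset.mem_Icc, Nat.mem_divisors] at hc ⊢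
        obtain ⟨⟨⟨h1, h2⟩, h3⟩, ⟨e, rfl⟩, -⟩ := hc
        have hd : 0 < d := Nat.pos_of_ne_zero (by rintro rfl; simp at h1)
        have he : 0 < e := Nat.pos_of_ne_zero (by rintro rfl; simp at h1)
        rw [Nat.mul_div_cancel_left _ hd, Nat.floor_div_natCast]
        refine ⟨⟨hd, (Nat.le_mul_of_pos_right d he).trans h2⟩, ⟨he, ?_⟩,
          fun q hq hqe => h3 q hq (hqe.mul_left d)⟩
        rw [Nat.le_div_iff_mul_le hd, mul_comm]; exact h2
    _ = ∑ d ∈ Finset.Icc 1 ⌊y⌋₊, ((d.totient : ℝ))⁻¹ *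
          (((Finset.Icc 1 ⌊y / d⌋₊).filter good).card : ℝ) := by
        rw [Finset.sum_sigma]
        refine Finset.sum_congr rfl fun d _ => ?_
        simp only [Finset.sum_const, nsmul_eq_mul, mul_comm]
    _ ≤ ∑ d ∈ Finset.Icc 1 ⌊y⌋₊, (1 + A) * B * y * w * (d : ℝ) ^ (-(5 / 4) : ℝ) :=
        Finset.sum_le_sum hcount
    _ ≤ (1 + A) * B * y * w * (Z + 1) := by
        rw [← Finset.mul_sum]
        gcongr
        exact (hs.sum_le_tsum _ fun _ _ => by positivity).trans (by linarith)
    _ = _ := by ring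

theorem count_mul_of_periodic {P : ℕ → Prop} [DecidablePred P] {r : ℕ}
    (hP : Function.Periodic P r) (h : ℕ) : Nat.count P (r * h) = h * Nat.count P r := by
  induction h with
  | zero => simp
  | succ h ih =>
    have h1 : (fun k => P (r * h + k)) = P := by
      funext k
      have := hP.nat_mul h k
      rw [add_comm, mul_comm]
      simpa using this
    rw [Nat.mul_succ, Nat.count_add, ih]
    simp only [h1]
    ring

theorem card_filter_range_residues (P : Finset ℕ) (hP : ∀ q ∈ P, q.Prime)
    (good : ∀ q : ℕ, ZMod q → Prop) (g : ℕ) (hg : ∏ q ∈ P, q ∣ g)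
    [DecidablePred fun s : ℕ => ∀ q ∈ P, good q (s : ZMod q)] :
    (((Finset.range g).filter fun s : ℕ => ∀ q ∈ P, good q (s : ZMod q)).card : ℝ)
      = g * ∏ q ∈ P, ((Nat.card {z : ZMod q // good q z} : ℝ) / q) := by
  obtain ⟨h, rfl⟩ := hg
  set r := ∏ q ∈ P, q with hr
  have hr0 : r ≠ 0 := Finset.prod_ne_zero_iff.2 fun q hq => (hP q hq).ne_zero
  have : NeZero r := ⟨hr0⟩
  have hper : Function.Periodic (fun s : ℕ => ∀ q ∈ P, good q (s : ZMod q)) r := by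
    intro s
    refine propext (forall₂_congr fun q hq => ?_)
    have : ((r : ℕ) : ZMod q) = 0 := (ZMod.natCast_eq_zero_iff _ _).2 (Finset.dvd_prod_of_mem _ hq)
    rw [Nat.cast_add, this, add_zero]
  have hco : Pairwise (Function.onFun Nat.Coprime fun q : P => (q : ℕ)) := by
    intro a b hab
    exact (Nat.coprime_primes (hP a a.2) (hP b b.2)).2 fun h => hab (Subtype.ext h)
  have hr' : r = ∏ q : P, (q : ℕ) := by rw [hr, ← Finset.prod_coe_sort]
  have hcount : Nat.count (fun s : ℕ => ∀ q ∈ P, good q (s : ZMod q)) r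
      = ∏ q ∈ P, Nat.card {z : ZMod q // good q z} := by
    rw [Nat.count_eq_card_filter_range, ← Finset.prod_coe_sort P
      (fun q => Nat.card {z : ZMod q // good q z}), ← Nat.card_pi,
      ← Nat.subtype_card (p := fun s : ℕ => s < r ∧ ∀ q ∈ P, good q (s : ZMod q)) _ (by simp)]
    let e := ZMod.prodEquivPi (fun q : P => (q : ℕ)) hco
    have he : ∀ (s : ℕ) (q : P), e (s : ZMod _) q = (s : ZMod (q : ℕ)) := fun s q => by
      rw [map_natCast]; rfl
    refine Nat.card_eq_of_bijective (fun s q => ⟨((s : ℕ) : ZMod (q : ℕ)), s.2.2 q q.2⟩) ⟨?_, ?_⟩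
    · rintro ⟨s, hs, hs'⟩ ⟨u, hu, hu'⟩ h
      have h1 : e (s : ZMod _) = e (u : ZMod _) := by
        funext q
        rw [he, he]
        exact congrArg Subtype.val (congrFun h q)
      have h2 := (ZMod.natCast_eq_natCast_iff' _ _ _).1 (e.injective h1)
      rw [← hr', Nat.mod_eq_of_lt hs, Nat.mod_eq_of_lt hu] at h2
      exact Subtype.ext h2
    · intro z
      have : NeZero (∏ q : P, (q : ℕ)) := ⟨hr' ▸ hr0⟩
      obtain ⟨x, hx⟩ := e.surjective fun q => (z q).1
      have hv : ∀ q : P, ((x.val : ℕ) : ZMod (q : ℕ)) = (z q).1 := fun q => by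
        rw [← he, ZMod.natCast_zmod_val, hx]
      refine ⟨⟨x.val, (ZMod.val_lt x).trans_eq hr'.symm, fun q hq => ?_⟩, ?_⟩
      · rw [hv ⟨q, hq⟩]; exact (z ⟨q, hq⟩).2
      · funext q
        exact Subtype.ext (hv q)
  rw [← Nat.count_eq_card_filter_range, count_mul_of_periodic hper, hcount]
  rw [Finset.prod_div_distrib]
  have : (∏ q ∈ P, (q : ℝ)) = r := by rw [hr]; push_cast; rfl
  rw [this]
  have : (r : ℝ) ≠ 0 := by exact_mod_cast hr0
  push_cast
  field_simp

/-- The reduced residues modulo `n`, as integers in `[0, n)`. -/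
def reducedResidues (n : ℕ) : Finset ℕ := (Finset.range n).filter fun a => n.Coprime a

theorem card_reducedResidues (n : ℕ) : (reducedResidues n).card = n.totient := rfl

theorem mem_reducedResidues {n a : ℕ} : a ∈ reducedResidues n ↔ a < n ∧ n.Coprime a := by
  simp [reducedResidues]

theorem natCard_subtype_div_le_one_sub_inv {q : ℕ} (hq : q.Prime) (good : ZMod q → Prop)
    (z : ZMod q) (hz : ¬ good z) : (Nat.card {z : ZMod q // good z} : ℝ) / q ≤ 1 - (q : ℝ)⁻¹ := by
  classical
  have : NeZero q := ⟨hq.ne_zero⟩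
  have hq0 : (0 : ℝ) < q := by exact_mod_cast hq.pos
  have h : Nat.card {z : ZMod q // good z} + 1 ≤ q := by
    rw [Nat.card_eq_fintype_card, Fintype.card_subtype, ← Finset.card_singleton z,
      ← Finset.card_union_of_disjoint]
    · exact (Finset.card_le_univ _).trans_eq (ZMod.card q)
    · simpa using hz
  have h' : (Nat.card {z : ZMod q // good z} : ℝ) + 1 ≤ q := by exact_mod_cast h
  rw [div_le_iff₀ hq0, sub_mul, inv_mul_cancel₀ hq0.ne']
  linarith

theorem natCard_subtype_div_le_one_sub_inv_sq {q : ℕ} (hq : q.Prime) (good : ZMod q → Prop)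
    (z z' : ZMod q) (hz : ¬ good z) (hz' : ¬ good z') (hne : z ≠ z') :
    (Nat.card {z : ZMod q // good z} : ℝ) / q ≤ (1 - (q : ℝ)⁻¹) ^ 2 := by
  classical
  have : NeZero q := ⟨hq.ne_zero⟩
  have hq0 : (0 : ℝ) < q := by exact_mod_cast hq.pos
  have h : Nat.card {z : ZMod q // good z} + 2 ≤ q := by
    rw [Nat.card_eq_fintype_card, Fintype.card_subtype, ← Finset.card_pair hne,
      ← Finset.card_union_of_disjoint]
    · exact (Finset.card_le_univ _).trans_eq (ZMod.card q)
    · simp [hz, hz']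
  have h' : (Nat.card {z : ZMod q // good z} : ℝ) + 2 ≤ q := by exact_mod_cast h
  have h2 : (Nat.card {z : ZMod q // good z} : ℝ) / q ≤ 1 - 2 * (q : ℝ)⁻¹ := by
    rw [div_le_iff₀ hq0, sub_mul, mul_assoc, inv_mul_cancel₀ hq0.ne']
    linarith
  nlinarith [sq_nonneg ((q : ℝ)⁻¹)]

/-- The pairs of reduced fractions `a / (g * m)` and `b / (g * n)` with `a * n - b * m = c`. -/
def fractionPairs (g m n : ℕ) (c : ℤ) : Finset (ℕ × ℕ) :=
  (reducedResidues (g * m) ×ˢ reducedResidues (g * n)).filter fun x =>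
    (x.1 : ℤ) * n - x.2 * m = c

theorem fractionPairs_eq_empty {g m n q : ℕ} {c : ℤ} (hmn : m.Coprime n) (hq : q.Prime)
    (hqt : q ∣ m * n) (hqc : (q : ℤ) ∣ c) : fractionPairs g m n c = ∅ := by
  rw [Finset.eq_empty_iff_forall_notMem]
  rintro ⟨a, b⟩ h
  simp only [fractionPairs, Finset.mem_filter, Finset.mem_product, mem_reducedResidues] at h
  obtain ⟨⟨⟨-, ha⟩, ⟨-, hb⟩⟩, rfl⟩ := h
  have hqp := Nat.prime_iff_prime_int.1 hq
  rcases hq.dvd_mul.1 hqt with hm | hn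
  · have h1 : (q : ℤ) ∣ (a : ℤ) * n :=
      (dvd_sub_left ((Int.natCast_dvd_natCast.2 hm).mul_left _)).1 hqc
    have h2 : q ∣ a * n := by exact_mod_cast h1
    rcases hq.dvd_mul.1 h2 with h3 | h3
    · exact Nat.not_coprime_of_dvd_of_dvd hq.one_lt (hm.mul_left g) h3 ha
    · exact Nat.not_coprime_of_dvd_of_dvd hq.one_lt hm h3 hmn
  · have h1 : (q : ℤ) ∣ (b : ℤ) * m :=
      (dvd_sub_right ((Int.natCast_dvd_natCast.2 hn).mul_left _)).1 hqc
    have h2 : q ∣ b * m := by exact_mod_cast h1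
    rcases hq.dvd_mul.1 h2 with h3 | h3
    · exact Nat.not_coprime_of_dvd_of_dvd hq.one_lt (hn.mul_left g) h3 hb
    · exact Nat.not_coprime_of_dvd_of_dvd hq.one_lt h3 hn hmn

theorem card_fractionPairs_le_prod {g m n : ℕ} (hg : g ≠ 0) (hm : m ≠ 0)
    (hmn : m.Coprime n) (c : ℤ) :
    ((fractionPairs g m n c).card : ℝ) ≤ g * ∏ q ∈ g.primeFactors,
      (if q ∣ m * n * c.natAbs then 1 - (q : ℝ)⁻¹ else (1 - (q : ℝ)⁻¹) ^ 2) := by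
  classical
  rcases (fractionPairs g m n c).eq_empty_or_nonempty with h | ⟨⟨a₀, b₀⟩, h₀⟩
  · rw [h, Finset.card_empty, Nat.cast_zero]
    refine mul_nonneg (by positivity) (Finset.prod_nonneg fun q hq => ?_)
    have := (one_sub_inv_prime_pos (Nat.prime_of_mem_primeFactors hq)).le
    split_ifs <;> positivity
  have h₀c : (a₀ : ℤ) * n - b₀ * m = c := (Finset.mem_filter.1 h₀).2
  set ρ : ℕ := a₀ % m with hρ
  set β : ℤ := b₀ - n * (a₀ / m : ℕ) with hβ
  have hm' : (m : ℤ) ≠ 0 := by exact_mod_cast hm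
  have hρβ : (ρ : ℤ) * n - β * m = c := by
    have h1 : (ρ : ℤ) + m * (a₀ / m : ℕ) = a₀ := by exact_mod_cast Nat.mod_add_div a₀ m
    rw [← h₀c, ← h1, hβ]; ring
  let good : ∀ q : ℕ, ZMod q → Prop := fun q z => (ρ : ZMod q) + m * z ≠ 0 ∧ (β : ZMod q) + n * z ≠ 0
  have hparam : ∀ x ∈ fractionPairs g m n c, x.1 = ρ + m * (x.1 / m) ∧
      (x.2 : ℤ) = β + n * (x.1 / m : ℕ) := by
    rintro ⟨a, b⟩ hx
    have hc : (a : ℤ) * n - b * m = c := (Finset.mem_filter.1 hx).2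
    have h1 : a % m = ρ := by
      have h2 : (m : ℤ) ∣ (a - a₀) * n := ⟨b - b₀, by linear_combination hc - h₀c⟩
      have h3 : (m : ℤ) ∣ a - a₀ :=
        (Nat.isCoprime_iff_coprime.2 hmn).dvd_of_dvd_mul_right h2
      exact ((Int.natCast_modEq_iff).1 ((Int.modEq_iff_dvd.2 h3))).symm
    have h4 : a = ρ + m * (a / m) := by rw [← h1, Nat.mod_add_div]
    refine ⟨h4, ?_⟩
    have h5 : (a : ℤ) = ρ + m * (a / m : ℕ) := by exact_mod_cast h4
    refine mul_right_cancel₀ hm' ?_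
    simp only
    rw [h5] at hc
    linear_combination hρβ - hc
  have hle : (fractionPairs g m n c).card ≤ ((Finset.range g).filter fun s : ℕ =>
      ∀ q ∈ g.primeFactors, good q (s : ZMod q)).card := by
    refine Finset.card_le_card_of_injOn (fun x => x.1 / m) ?_ ?_
    · rintro ⟨a, b⟩ hx
      obtain ⟨h1, h2⟩ := hparam _ hx
      have hx' := (Finset.mem_filter.1 hx).1
      simp only [Finset.mem_product, mem_reducedResidues] at hx' h1 h2
      obtain ⟨⟨ha, ha'⟩, ⟨-, hb'⟩⟩ := hx'
      simp only [Finset.coe_filter, Set.mem_ofPred_eq, Finset.mem_range]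
      refine ⟨Nat.div_lt_of_lt_mul (by rwa [mul_comm]), fun q hq => ⟨fun h => ?_, fun h => ?_⟩⟩
      · have h3 : (a : ZMod q) = 0 := by rw [h1]; push_cast; exact h
        exact Nat.not_coprime_of_dvd_of_dvd (Nat.prime_of_mem_primeFactors hq).one_lt
          ((Nat.dvd_of_mem_primeFactors hq).mul_right m) ((ZMod.natCast_eq_zero_iff _ _).1 h3) ha'
      · have h3 : ((b : ℤ) : ZMod q) = 0 := by
          rw [h2]; simp only [Int.cast_add, Int.cast_mul, Int.cast_natCast]; exact h
        rw [Int.cast_natCast] at h3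
        exact Nat.not_coprime_of_dvd_of_dvd (Nat.prime_of_mem_primeFactors hq).one_lt
          ((Nat.dvd_of_mem_primeFactors hq).mul_right n) ((ZMod.natCast_eq_zero_iff _ _).1 h3) hb'
    · rintro ⟨a, b⟩ hx ⟨a', b'⟩ hx' h
      obtain ⟨h1, h2⟩ := hparam _ hx
      obtain ⟨h1', h2'⟩ := hparam _ hx'
      simp only at h h1 h2 h1' h2'
      rw [h, ← h1'] at h1
      rw [h, ← h2'] at h2
      rw [h1, Nat.cast_injective h2]
  refine (Nat.cast_le.2 hle).trans ?_
  rw [card_filter_range_residues _ (fun q hq => Nat.prime_of_mem_primeFactors hq) good g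
    (Nat.prod_primeFactors_dvd g)]
  refine mul_le_mul_of_nonneg_left (Finset.prod_le_prod (fun q _ => by positivity) fun q hq => ?_)
    (by positivity)
  have hq := Nat.prime_of_mem_primeFactors hq
  have : Fact q.Prime := ⟨hq⟩
  have root₁ : ¬ q ∣ m → ¬ good q (-(ρ : ZMod q) / m) := fun h hz => hz.1 (by
    have : (m : ZMod q) ≠ 0 := fun h' => h ((ZMod.natCast_eq_zero_iff _ _).1 h')
    field_simp; ring)
  have root₂ : ¬ q ∣ n → ¬ good q (-(β : ZMod q) / n) := fun h hz => hz.2 (by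
    have : (n : ZMod q) ≠ 0 := fun h' => h ((ZMod.natCast_eq_zero_iff _ _).1 h')
    field_simp; ring)
  split_ifs with hd
  · by_cases h : q ∣ m
    · have h' : ¬ q ∣ n := fun h' => Nat.not_coprime_of_dvd_of_dvd hq.one_lt h h' hmn
      exact natCard_subtype_div_le_one_sub_inv hq _ _ (root₂ h')
    · exact natCard_subtype_div_le_one_sub_inv hq _ _ (root₁ h)
  · have hqm : ¬ q ∣ m := fun h => hd ((h.mul_right n).mul_right _)
    have hqn : ¬ q ∣ n := fun h => hd ((h.mul_left m).mul_right _)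
    have hqc : ¬ q ∣ c.natAbs := fun h => hd (h.mul_left _)
    refine natCard_subtype_div_le_one_sub_inv_sq hq _ _ _ (root₁ hqm) (root₂ hqn) fun h => hqc ?_
    have h1 : (m : ZMod q) ≠ 0 := fun h' => hqm ((ZMod.natCast_eq_zero_iff _ _).1 h')
    have h2 : (n : ZMod q) ≠ 0 := fun h' => hqn ((ZMod.natCast_eq_zero_iff _ _).1 h')
    rw [div_eq_div_iff h1 h2] at h
    rw [← Int.natCast_dvd, ← ZMod.intCast_zmod_eq_zero_iff_dvd c q, ← hρβ]
    push_cast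
    linear_combination -h

theorem card_fractionPairs_mul_le {g m n : ℕ} (hg : g ≠ 0) (hm : m ≠ 0) (hn : n ≠ 0)
    (hmn : m.Coprime n) {c : ℤ} (hc : c ≠ 0) :
    ((fractionPairs g m n c).card : ℝ) * coprimeDensity (m * n) * coprimeDensity c.natAbs
      ≤ g * coprimeDensity (g * m) * coprimeDensity (g * n) := by
  classical
  have hc' : c.natAbs ≠ 0 := Int.natAbs_ne_zero.2 hc
  set x : ℕ → ℝ := fun q => 1 - (q : ℝ)⁻¹ with hx
  have hx0 : ∀ q, q.Prime → 0 < x q := fun q hq => one_sub_inv_prime_pos hq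
  set A := g.primeFactors
  set B := m.primeFactors
  set D := n.primeFactors
  set E := c.natAbs.primeFactors
  have hU : ∀ S : Finset ℕ, S ⊆ A ∪ B ∪ D ∪ E → ∏ q ∈ S, x q =
      ∏ q ∈ A ∪ B ∪ D ∪ E, if q ∈ S then x q else 1 := fun S hS => by
    rw [← Finset.prod_filter, Finset.filter_mem_eq_inter, Finset.inter_eq_right.2 hS]
  refine (mul_le_mul_of_nonneg_right (mul_le_mul_of_nonneg_right
    (card_fractionPairs_le_prod hg hm hmn c) (coprimeDensity_pos _).le)
    (coprimeDensity_pos _).le).trans ?_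
  rw [mul_assoc, mul_assoc (g : ℝ), mul_assoc (g : ℝ)]
  refine mul_le_mul_of_nonneg_left ?_ (by positivity)
  have e0 : (∏ q ∈ A, if q ∣ m * n * c.natAbs then 1 - (q : ℝ)⁻¹ else (1 - (q : ℝ)⁻¹) ^ 2)
      = ∏ q ∈ A ∪ B ∪ D ∪ E, if q ∈ A then (if q ∈ B ∪ D ∪ E then x q else x q ^ 2) else 1 := by
    rw [← Finset.prod_filter, Finset.filter_mem_eq_inter, Finset.inter_eq_right.2 (by grind)]
    refine Finset.prod_congr rfl fun q hq => ?_
    have hq := Nat.prime_of_mem_primeFactors hq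
    have : q ∣ m * n * c.natAbs ↔ q ∈ B ∪ D ∪ E := by
      simp only [Finset.mem_union, B, D, E, Nat.mem_primeFactors, hq, hq.dvd_mul]
      tauto
    simp only [this, hx]
  have hBD : Disjoint B D := hmn.disjoint_primeFactors
  rw [e0]
  simp only [coprimeDensity, Nat.primeFactors_mul hg hm, Nat.primeFactors_mul hg hn,
    Nat.primeFactors_mul hm hn]
  rw [hU (A ∪ B) (by grind), hU (A ∪ D) (by grind), hU (B ∪ D) (by grind),
    hU E (by grind), ← Finset.prod_mul_distrib, ← Finset.prod_mul_distrib,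
    ← Finset.prod_mul_distrib]
  refine Finset.prod_le_prod ?_ ?_
  · intro q hq
    have hq' : q.Prime := by
      simp only [Finset.mem_union, A, B, D, E, Nat.mem_primeFactors] at hq
      tauto
    have := (hx0 q hq').le
    split_ifs <;> positivity
  · intro q hq
    have hq' : q.Prime := by
      simp only [Finset.mem_union, A, B, D, E, Nat.mem_primeFactors] at hq
      tauto
    have h0 := (hx0 q hq').le
    have h1 : x q ≤ 1 := one_sub_inv_natCast_le_one q
    have h3 : ¬ (q ∈ B ∧ q ∈ D) := fun h => Finset.disjoint_left.1 hBD h.1 h.2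
    have h2 : x q ^ 2 ≤ x q := by nlinarith
    by_cases hA : q ∈ A <;> by_cases hB : q ∈ B <;> by_cases hD : q ∈ D <;> by_cases hE : q ∈ E <;>
      simp [hA, hB, hD, hE] at h3 ⊢ <;> nlinarith

theorem card_fractionPairs_zero_le {g m n : ℕ} (hmn : m.Coprime n) :
    (fractionPairs g m n 0).card ≤ if g * m = g * n then (g * n).totient else 0 := by
  by_cases h1 : m * n = 1
  · obtain ⟨rfl, rfl⟩ := mul_eq_one.1 h1
    rw [if_pos rfl, ← card_reducedResidues]
    refine Finset.card_le_card_of_injOn Prod.fst ?_ ?_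
    · rintro ⟨a, b⟩ h
      simp only [fractionPairs, Finset.coe_filter, Finset.mem_product, Set.mem_ofPred_eq] at h
      exact h.1.1
    · rintro ⟨a, b⟩ h ⟨a', b'⟩ h' e
      simp only [fractionPairs, Finset.coe_filter, Finset.mem_product, Set.mem_ofPred_eq] at h h' e
      have := h.2
      have := h'.2
      ext <;> omega
  · obtain ⟨q, hq, hqt⟩ := Nat.exists_prime_and_dvd h1
    rw [fractionPairs_eq_empty hmn hq hqt (dvd_zero _)]
    simp

theorem exists_card_close_pairs_mul_le :
    ∃ C : ℕ, ∀ g m n M : ℕ, g ≠ 0 → m ≠ 0 → n ≠ 0 → m.Coprime n → 0 < M →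
      M ≤ g * m → M ≤ g * n →
      ((reducedResidues (g * m) ×ˢ reducedResidues (g * n)).filter fun x =>
        |(x.1 : ℤ) * n - x.2 * m| * M < g * m * n).card * M ≤
        C * ((g * m).totient * (g * n).totient) +
          if g * m = g * n then (g * n).totient * M else 0 := by
  classical
  obtain ⟨C, hC, hsieve⟩ := exists_sum_inv_coprimeDensity_le
  obtain ⟨K, hK⟩ := exists_nat_ge (2 * C)
  refine ⟨K, fun g m n M hg hm hn hmn hM hMm hMn => ?_⟩
  set S := (reducedResidues (g * m) ×ˢ reducedResidues (g * n)).filter fun x =>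
        |(x.1 : ℤ) * n - x.2 * m| * M < g * m * n with hS
  have hg0 : (0 : ℝ) < g := by exact_mod_cast Nat.pos_of_ne_zero hg
  have hm0 : (0 : ℝ) < m := by exact_mod_cast Nat.pos_of_ne_zero hm
  have hn0 : (0 : ℝ) < n := by exact_mod_cast Nat.pos_of_ne_zero hn
  have hM0 : (0 : ℝ) < M := by exact_mod_cast hM
  set y : ℝ := g * m * n / M with hy
  have hy0 : 0 ≤ y := by positivity
  have hym : (m : ℝ) ≤ y := by
    rw [hy, le_div_iff₀ hM0]
    have : (M : ℝ) ≤ g * n := by exact_mod_cast hMn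
    nlinarith
  have hyn : (n : ℝ) ≤ y := by
    rw [hy, le_div_iff₀ hM0]
    have : (M : ℝ) ≤ g * m := by exact_mod_cast hMm
    nlinarith
  have hty : ((m * n : ℕ) : ℝ) ≤ y ^ 2 := by
    push_cast; rw [sq]; exact mul_le_mul hym hyn hn0.le hy0
  set w := coprimeDensity (m * n) with hw
  have hw0 : 0 < w := coprimeDensity_pos _
  set W : ℝ := g * coprimeDensity (g * m) * coprimeDensity (g * n) with hW
  have hW0 : 0 ≤ W := by
    have := (coprimeDensity_pos (g * m)).le
    have := (coprimeDensity_pos (g * n)).le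
    positivity
  have hbound : ∀ c : ℤ, c ≠ 0 → ((fractionPairs g m n c).card : ℝ) ≤
      if ∀ q ∈ (m * n).primeFactors, ¬ q ∣ c.natAbs then
        W / w * (coprimeDensity c.natAbs)⁻¹ else 0 := by
    intro c hc
    split_ifs with h
    · have hwc := coprimeDensity_pos c.natAbs
      rw [← div_eq_mul_inv, le_div_iff₀ hwc, le_div_iff₀ hw0, mul_right_comm]
      exact card_fractionPairs_mul_le hg hm hn hmn hc
    · push Not at h
      obtain ⟨q, hq, hqc⟩ := h
      rw [fractionPairs_eq_empty hmn (Nat.prime_of_mem_primeFactors hq)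
        (Nat.dvd_of_mem_primeFactors hq) (Int.natCast_dvd.2 hqc)]
      simp
  have hsum : ∀ ε : ℤ, ε.natAbs = 1 →
      ∑ c ∈ Finset.Icc 1 ⌊y⌋₊, ((fractionPairs g m n (ε * (c : ℤ))).card : ℝ) ≤ W * C * y := by
    intro ε hε
    calc ∑ c ∈ Finset.Icc 1 ⌊y⌋₊, ((fractionPairs g m n (ε * (c : ℤ))).card : ℝ)
        ≤ ∑ c ∈ Finset.Icc 1 ⌊y⌋₊, if ∀ q ∈ (m * n).primeFactors, ¬ q ∣ c then
            W / w * (coprimeDensity c)⁻¹ else 0 := by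
          refine Finset.sum_le_sum fun c hc => ?_
          have hc1 := (Finset.mem_Icc.1 hc).1
          have := hbound (ε * c) (mul_ne_zero (by rintro rfl; simp at hε) (by omega))
          simpa only [Int.natAbs_mul, hε, one_mul, Int.natAbs_natCast] using this
      _ = W / w * ∑ c ∈ (Finset.Icc 1 ⌊y⌋₊).filter (fun c => ∀ q ∈ (m * n).primeFactors, ¬ q ∣ c),
            (coprimeDensity c)⁻¹ := by rw [← Finset.sum_filter, Finset.mul_sum]
      _ ≤ W / w * (C * y * w) := by
          gcongr
          exact hsieve (m * n) (mul_ne_zero hm hn) y hy0 hty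
      _ = W * C * y := by field_simp
  have hcover : S ⊆ fractionPairs g m n 0 ∪
      ((Finset.Icc 1 ⌊y⌋₊).biUnion fun c => fractionPairs g m n (1 * (c : ℤ))) ∪
      ((Finset.Icc 1 ⌊y⌋₊).biUnion fun c => fractionPairs g m n (-1 * (c : ℤ))) := by
    intro x hx
    obtain ⟨hx1, hx2⟩ := Finset.mem_filter.1 hx
    set c : ℤ := (x.1 : ℤ) * n - x.2 * m with hc
    have hmem : x ∈ fractionPairs g m n c := Finset.mem_filter.2 ⟨hx1, rfl⟩
    have habs : c.natAbs ≤ ⌊y⌋₊ := by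
      rw [Nat.le_floor_iff hy0, hy, le_div_iff₀ hM0]
      have : ((c.natAbs * M : ℕ) : ℤ) < ((g * m * n : ℕ) : ℤ) := by
        push_cast; exact hx2
      exact_mod_cast (Nat.cast_lt.1 this).le
    simp only [Finset.mem_union, Finset.mem_biUnion, Finset.mem_Icc]
    rcases lt_trichotomy c 0 with h | h | h
    · refine Or.inr ⟨c.natAbs, ⟨by omega, habs⟩, ?_⟩
      rwa [show -1 * (c.natAbs : ℤ) = c by omega]
    · exact Or.inl (Or.inl (h ▸ hmem))
    · refine Or.inl (Or.inr ⟨c.natAbs, ⟨by omega, habs⟩, ?_⟩)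
      rwa [show 1 * (c.natAbs : ℤ) = c by omega]
  have hcard : (S.card : ℝ) ≤ (fractionPairs g m n 0).card + 2 * (W * C * y) := by
    have h1 : S.card ≤ (fractionPairs g m n 0).card
        + ∑ c ∈ Finset.Icc 1 ⌊y⌋₊, (fractionPairs g m n (1 * (c : ℤ))).card
        + ∑ c ∈ Finset.Icc 1 ⌊y⌋₊, (fractionPairs g m n (-1 * (c : ℤ))).card :=
      (Finset.card_le_card hcover).trans <| (Finset.card_union_le _ _).trans <|
        add_le_add ((Finset.card_union_le _ _).trans (add_le_add le_rfl Finset.card_biUnion_le))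
          Finset.card_biUnion_le
    have h2 := (Nat.cast_le (α := ℝ)).2 h1
    push_cast at h2
    have := hsum 1 rfl
    have := hsum (-1) rfl
    linarith
  have htot : W * y * M = (g * m).totient * (g * n).totient := by
    rw [totient_eq_mul_coprimeDensity, totient_eq_mul_coprimeDensity, hW, hy]
    push_cast
    field_simp
  have hzero : ((fractionPairs g m n 0).card : ℝ) * M ≤
      ((if g * m = g * n then (g * n).totient * M else 0 : ℕ) : ℝ) := by
    have := Nat.mul_le_mul_right M (card_fractionPairs_zero_le (g := g) hmn)
    rw [ite_mul, zero_mul] at this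
    exact_mod_cast this
  have hfinal : (S.card : ℝ) * M ≤ K * ((g * m).totient * (g * n).totient) +
      ((if g * m = g * n then (g * n).totient * M else 0 : ℕ) : ℝ) := by
    calc (S.card : ℝ) * M ≤ ((fractionPairs g m n 0).card + 2 * (W * C * y)) * M := by gcongr
      _ = 2 * C * (W * y * M) + (fractionPairs g m n 0).card * M := by ring
      _ ≤ _ := by
        rw [htot]
        gcongr
  exact_mod_cast hfinal

/-- Pairs of reduced fractions with denominators `m, n` at distance less than `1 / M` are
quasi-independent when `M ≤ min m n`. -/
theorem exists_card_close_fractions_mul_le :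
    ∃ C : ℕ, ∀ m n M : ℕ, 0 < M → M ≤ m → M ≤ n →
      ((reducedResidues m ×ˢ reducedResidues n).filter fun x =>
        |(x.1 : ℤ) * n - x.2 * m| * M < m * n).card * M ≤
        C * (m.totient * n.totient) + if m = n then n.totient * M else 0 := by
  obtain ⟨C, hC⟩ := exists_card_close_pairs_mul_le
  refine ⟨C, fun m n M hM hm hn => ?_⟩
  obtain ⟨m', n', hmn, em, en⟩ := Nat.exists_coprime m n
  set g := m.gcd n with hgdef
  have hg : 0 < g := Nat.gcd_pos_of_pos_left _ (by omega)
  rw [mul_comm] at em en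
  have := hC g m' n' M hg.ne' (by rintro rfl; simp at em; omega) (by rintro rfl; simp at en; omega)
    hmn hM (em ▸ hm) (en ▸ hn)
  rw [← em, ← en] at this
  refine le_trans (Nat.mul_le_mul_right M (Finset.card_le_card ?_)) this
  refine Finset.monotone_filter_right _ fun x _ hx => ?_
  have hg' : (0 : ℤ) < g := by exact_mod_cast hg
  have e1 : (x.1 : ℤ) * n - x.2 * m = g * (x.1 * n' - x.2 * m') := by
    rw [em, en]; push_cast; ring
  have e2 : (m : ℤ) * n = g * (g * m' * n') := by
    rw [em, en]; push_cast; ring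
  rw [e1, e2, abs_mul, abs_of_pos hg', mul_assoc] at hx
  exact lt_of_mul_lt_mul_left hx hg'.le

/-- Kochen–Stone: if the partial sums of `f n` diverge in mean and are infinitely often
quasi-independent on average, infinitely many `f n` are nonzero on a set of positive measure. -/
theorem measure_infinite_support_ne_zero {Ω : Type*} [MeasurableSpace Ω] {μ : Measure Ω}
    [IsFiniteMeasure μ] {f : ℕ → Ω → ENNReal} (hf : ∀ n, Measurable (f n))
    (hfin : ∀ n, ∫⁻ x, f n x ∂μ ≠ ⊤)
    (hdiv : Tendsto (fun N => ∑ n ∈ Finset.Icc 1 N, ∫⁻ x, f n x ∂μ) atTop (nhds ⊤))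
    {C : ENNReal} (hC : C ≠ ⊤)
    (hqi : ∃ᶠ N in atTop, ∑ m ∈ Finset.Icc 1 N, ∑ n ∈ Finset.Icc 1 N, ∫⁻ x, f m x * f n x ∂μ ≤
      C * (∑ n ∈ Finset.Icc 1 N, ∫⁻ x, f n x ∂μ) ^ 2) :
    μ {x | {n | f n x ≠ 0}.Infinite} ≠ 0 := by
  intro hzero
  set V : ℕ → Set Ω := fun K => {x | ∃ n > K, f n x ≠ 0} with hV
  have hVmeas : ∀ K, MeasurableSet (V K) := fun K => by
    have : V K = ⋃ n, ⋃ (_ : n > K), {x | f n x ≠ 0} := by ext x; simp [hV]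
    rw [this]
    exact MeasurableSet.iUnion fun n => MeasurableSet.iUnion fun _ =>
      (hf n (measurableSet_singleton 0)).compl
  have hVlim : Tendsto (fun K => μ (V K)) atTop (nhds 0) := by
    have h1 : ⋂ K, V K = {x | {n | f n x ≠ 0}.Infinite} := by
      ext x
      simp only [hV, Set.mem_iInter, Set.mem_ofPred_eq]
      rw [← Nat.frequently_atTop_iff_infinite, frequently_atTop']
    rw [← hzero, ← h1]
    exact tendsto_measure_iInter_atTop (fun K => (hVmeas K).nullMeasurableSet)
      (fun a b hab x ⟨n, hn, hx⟩ => ⟨n, lt_of_le_of_lt hab hn, hx⟩) ⟨0, measure_ne_top _ _⟩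
  have hCV : Tendsto (fun K => C * μ (V K)) atTop (nhds 0) := by
    simpa using ENNReal.Tendsto.const_mul hVlim (Or.inr hC)
  obtain ⟨K, hK⟩ := (hCV.eventually (Iic_mem_nhds (show (0 : ENNReal) < 4⁻¹ by simp))).exists
  set s : ℕ → ENNReal := fun N => ∑ n ∈ Finset.Icc 1 N, ∫⁻ x, f n x ∂μ with hs
  have hsfin : ∀ N, s N ≠ ⊤ := fun N => ENNReal.sum_ne_top.2 fun n _ => hfin n
  have key : ∃ᶠ N in atTop, s N ≤ 2 * s K := by
    refine hqi.mono fun N hN => ?_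
    set F : Ω → ENNReal := fun x => ∑ n ∈ Finset.Icc 1 N, f n x with hF
    have hFm : Measurable F := Finset.measurable_fun_sum _ fun n _ => hf n
    have hFint : ∫⁻ x, F x ∂μ = s N := lintegral_finsetSum _ fun n _ => hf n
    have hFsq : ∫⁻ x, F x ^ (2 : ℝ) ∂μ ≤ C * s N ^ 2 := by
      refine le_trans (le_of_eq ?_) hN
      simp_rw [ENNReal.rpow_two, hF, sq, Finset.sum_mul_sum]
      have hmul : ∀ m n, Measurable fun x => f m x * f n x := fun m n => (hf m).mul (hf n)
      rw [lintegral_finsetSum _ fun m _ => Finset.measurable_fun_sum _ fun n _ => hmul m n]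
      exact Finset.sum_congr rfl fun m _ => lintegral_finsetSum _ fun n _ => hmul m n
    set I : Ω → ENNReal := (V K).indicator 1 with hI
    have hIm : Measurable I := measurable_one.indicator (hVmeas K)
    have hIsq : ∫⁻ x, I x ^ (2 : ℝ) ∂μ = μ (V K) := by
      rw [← lintegral_indicator_one (hVmeas K)]
      refine lintegral_congr fun x => ?_
      by_cases hx : x ∈ V K <;> simp [hI, hx]
    have hpt : ∀ x, F x ≤ ∑ n ∈ Finset.Icc 1 K, f n x + (F * I) x := by
      intro x
      by_cases hx : x ∈ V K
      · simp [hI, hx]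
      · refine le_trans ?_ le_self_add
        refine Finset.sum_le_sum_of_ne_zero fun n hn h => ?_
        by_contra hcon
        exact hx ⟨n, by simp only [Finset.mem_Icc] at hn hcon; omega, h⟩
    have hcs : ∫⁻ x, (F * I) x ∂μ ≤ s N * 2⁻¹ := by
      refine (ENNReal.lintegral_mul_le_Lp_mul_Lq μ Real.HolderConjugate.two_two
        hFm.aemeasurable hIm.aemeasurable).trans ?_
      rw [hIsq, ← ENNReal.mul_rpow_of_nonneg _ _ (by norm_num)]
      calc _ ≤ ((s N * 2⁻¹) ^ 2) ^ (1 / 2 : ℝ) := by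
            gcongr
            calc _ ≤ C * s N ^ 2 * μ (V K) := by gcongr
              _ = s N ^ 2 * (C * μ (V K)) := by ring
              _ ≤ s N ^ 2 * 4⁻¹ := by gcongr
              _ = _ := by
                rw [mul_pow, ← ENNReal.inv_pow]; norm_num
        _ = _ := by
            rw [← ENNReal.rpow_two, ← ENNReal.rpow_mul]; norm_num
    have hsum : s N ≤ s K + s N * 2⁻¹ := by
      rw [← hFint]
      refine (lintegral_mono hpt).trans ?_
      rw [lintegral_add_left (Finset.measurable_fun_sum _ fun n _ => hf n), hFint,
        lintegral_finsetSum _ fun n _ => hf n]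
      gcongr
    have h2 : s N * 2⁻¹ + s N * 2⁻¹ ≤ s K + s N * 2⁻¹ := by
      rwa [← mul_add, ENNReal.inv_two_add_inv_two, mul_one]
    have h3 : s N * 2⁻¹ ≤ s K :=
      (ENNReal.add_le_add_iff_right (ENNReal.mul_ne_top (hsfin N) (by simp))).1 h2
    calc s N = 2 * (s N * 2⁻¹) := by
          rw [mul_left_comm, ENNReal.mul_inv_cancel (by simp) (by simp), mul_one]
      _ ≤ _ := by gcongr
  have h2K : 2 * s K < ⊤ := ENNReal.mul_lt_top (by simp) (hsfin K).lt_top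
  obtain ⟨N, h1, h2⟩ := (key.and_eventually (hdiv.eventually (Ioi_mem_nhds h2K))).exists
  exact absurd h1 (not_le.2 h2)

/-- The half-open block `[j / Q, (j + 1) / Q)`. -/
def realBlock (Q j : ℕ) : Set ℝ := Set.Ico ((j : ℝ) / Q) ((j + 1) / Q)

theorem measurableSet_realBlock (Q j : ℕ) : MeasurableSet (realBlock Q j) := measurableSet_Ico

theorem floor_mul_eq_of_mem_realBlock {Q j : ℕ} (hQ : 0 < Q) {x : ℝ} (hx : x ∈ realBlock Q j) :
    ⌊(Q : ℝ) * x⌋₊ = j := by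
  have hQ0 : (0 : ℝ) < Q := by exact_mod_cast hQ
  obtain ⟨h1, h2⟩ := hx
  rw [div_le_iff₀ hQ0] at h1
  rw [lt_div_iff₀ hQ0] at h2
  have hj : (0 : ℝ) ≤ j := Nat.cast_nonneg j
  rw [Nat.floor_eq_iff (by linarith)]
  constructor <;> linarith

theorem volume_realBlock {Q : ℕ} (hQ : 0 < Q) (j : ℕ) : volume (realBlock Q j) = (Q : ENNReal)⁻¹ := by
  have hQ0 : (0 : ℝ) < Q := by exact_mod_cast hQ
  rw [realBlock, Real.volume_Ico, ← sub_div, add_sub_cancel_left, one_div,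
    ENNReal.ofReal_inv_of_pos hQ0, ENNReal.ofReal_natCast]

theorem realBlock_subset {Q j : ℕ} (hj : j < Q) : realBlock Q j ⊆ Set.Ico 0 1 := by
  have hQ0 : (0 : ℝ) < Q := by exact_mod_cast (by omega : 0 < Q)
  refine Set.Ico_subset_Ico (by positivity) ?_
  rw [div_le_one hQ0]
  exact_mod_cast hj

/-- The number of reduced fractions `a / n` that lie in the same block of length `1 / Q` as `x`. -/
def fractionBlockCount (n Q : ℕ) (x : ℝ) : ENNReal :=
  ∑ a ∈ reducedResidues n, (realBlock Q (Q * a / n)).indicator 1 x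

theorem measurable_fractionBlockCount (n Q : ℕ) : Measurable (fractionBlockCount n Q) :=
  Finset.measurable_fun_sum _ fun _ _ => measurable_one.indicator (measurableSet_realBlock _ _)

theorem lintegral_fractionBlockCount (n : ℕ) {Q : ℕ} (hQ : 0 < Q) :
    ∫⁻ x in Set.Ico 0 1, fractionBlockCount n Q x = n.totient / Q := by
  simp_rw [fractionBlockCount]
  rw [lintegral_finsetSum _ fun _ _ => measurable_one.indicator (measurableSet_realBlock _ _)]
  have : ∀ a ∈ reducedResidues n,
      ∫⁻ x in Set.Ico (0 : ℝ) 1, (realBlock Q (Q * a / n)).indicator 1 x = (Q : ENNReal)⁻¹ := by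
    intro a ha
    have ha' := (mem_reducedResidues.1 ha).1
    rw [lintegral_indicator_one (measurableSet_realBlock _ _),
      Measure.restrict_apply (measurableSet_realBlock _ _),
      Set.inter_eq_left.2 (realBlock_subset _), volume_realBlock hQ]
    rw [Nat.div_lt_iff_lt_mul (by omega)]
    exact Nat.mul_lt_mul_of_pos_left ha' hQ
  rw [Finset.sum_congr rfl this, Finset.sum_const, card_reducedResidues, nsmul_eq_mul,
    div_eq_mul_inv]

theorem exists_abs_sub_lt_of_fractionBlockCount_ne_zero {n Q : ℕ} (hQ : 0 < Q) {x : ℝ}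
    (hx : fractionBlockCount n Q x ≠ 0) :
    ∃ a ∈ reducedResidues n, |x - a / n| < (Q : ℝ)⁻¹ := by
  obtain ⟨a, ha, hne⟩ := Finset.exists_ne_zero_of_sum_ne_zero hx
  refine ⟨a, ha, ?_⟩
  have hn0 : (0 : ℝ) < n := by exact_mod_cast (by have := (mem_reducedResidues.1 ha).1; omega : 0 < n)
  have hQ0 : (0 : ℝ) < Q := by exact_mod_cast hQ
  obtain ⟨h1, h2⟩ := Set.mem_of_indicator_ne_zero hne
  have h3 : ((Q * a / n : ℕ) : ℝ) / Q ≤ a / n := by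
    rw [div_le_iff₀ hQ0]
    refine Nat.cast_div_le.trans ?_
    push_cast
    exact le_of_eq (by ring)
  have h4 : (a : ℝ) / n < ((Q * a / n : ℕ) + 1) / Q := by
    rw [lt_div_iff₀ hQ0]
    have : ((Q * a : ℕ) : ℝ) / n < (Q * a / n : ℕ) + 1 := by
      rw [← Nat.floor_div_eq_div (K := ℝ)]
      exact Nat.lt_floor_add_one _
    refine lt_of_eq_of_lt ?_ this
    push_cast
    ring
  rw [add_div, one_div] at h2 h4
  rw [abs_lt]
  constructor <;> linarith

/-- The pairs of reduced fractions `a / m`, `b / n` lying in the same block of length `1 / q`. -/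
def sameBlockPairs (m n q : ℕ) : Finset (ℕ × ℕ) :=
  (reducedResidues m ×ˢ reducedResidues n).filter fun x => q * x.1 / m = q * x.2 / n

theorem lintegral_fractionBlockCount_mul_le (m n : ℕ) {q Q : ℕ} (hqQ : q ∣ Q) (hQ : 0 < Q) :
    ∫⁻ x in Set.Ico 0 1, fractionBlockCount m q x * fractionBlockCount n Q x ≤
      (sameBlockPairs m n q).card / Q := by
  obtain ⟨r, rfl⟩ := hqQ
  have hq : 0 < q := Nat.pos_of_mul_pos_right hQ
  have hr : 0 < r := Nat.pos_of_mul_pos_left hQ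
  have hpt : ∀ x, fractionBlockCount m q x * fractionBlockCount n (q * r) x ≤
      ∑ y ∈ sameBlockPairs m n q, (realBlock (q * r) (q * r * y.2 / n)).indicator 1 x := by
    intro x
    rw [fractionBlockCount, fractionBlockCount, Finset.sum_mul_sum, ← Finset.sum_product',
      sameBlockPairs, Finset.sum_filter]
    refine Finset.sum_le_sum ?_
    rintro ⟨a, b⟩ -
    by_cases h1 : x ∈ realBlock q (q * a / m)
    · by_cases h2 : x ∈ realBlock (q * r) (q * r * b / n)
      · have e : q * a / m = q * b / n := by
          rw [← floor_mul_eq_of_mem_realBlock hq h1]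
          have h3 := congrArg (· / r) (floor_mul_eq_of_mem_realBlock hQ h2)
          have hr0 : (r : ℝ) ≠ 0 := by exact_mod_cast hr.ne'
          simp only [← Nat.floor_div_natCast] at h3
          rw [Nat.div_div_eq_div_mul, mul_right_comm, Nat.mul_div_mul_right _ _ hr] at h3
          rw [← h3]
          congr 1
          push_cast
          field_simp
        simp only [if_pos e, Set.indicator_of_mem h1, Set.indicator_of_mem h2, Pi.one_apply, mul_one,
          le_refl]
      · simp [h2]
    · simp [h1]
  refine (lintegral_mono hpt).trans ?_
  rw [lintegral_finsetSum _ fun _ _ => measurable_one.indicator (measurableSet_realBlock _ _),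
    div_eq_mul_inv, ← nsmul_eq_mul]
  refine Finset.sum_le_card_nsmul _ _ _ fun y _ => ?_
  rw [lintegral_indicator_one (measurableSet_realBlock _ _), ← volume_realBlock hQ]
  exact Measure.restrict_apply_le _ _

theorem mul_lt_of_mem_sameBlockPairs {m n q : ℕ} {x : ℕ × ℕ} (hx : x ∈ sameBlockPairs m n q) :
    |(x.1 : ℤ) * n - x.2 * m| * q < m * n := by
  obtain ⟨hx1, h⟩ := Finset.mem_filter.1 hx
  obtain ⟨a, b⟩ := x
  simp only [Finset.mem_product, mem_reducedResidues] at hx1 h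
  have hm : 0 < m := by omega
  have hn : 0 < n := by omega
  have h1 := Nat.div_add_mod (q * a) m
  have h2 := Nat.div_add_mod (q * b) n
  have h3 := Nat.mod_lt (q * a) hm
  have h4 := Nat.mod_lt (q * b) hn
  rw [← h] at h2
  generalize q * a / m = t at *
  generalize (q * a) % m = u at *
  generalize (q * b) % n = v at *
  zify at h1 h2 h3 h4 hm hn
  have hu : (0 : ℤ) ≤ u := by positivity
  have hv : (0 : ℤ) ≤ v := by positivity
  have e : ((a : ℤ) * n - b * m) * q = u * n - v * m := by linear_combination (-n : ℤ) * h1 + m * h2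
  rw [← Nat.abs_cast q, ← abs_mul, e, abs_lt]
  constructor <;> nlinarith

theorem card_sameBlockPairs_le {m n q : ℕ} (hm : q.Coprime m) (hn : q.Coprime n) :
    (sameBlockPairs m n q).card ≤ ((reducedResidues m ×ˢ reducedResidues n).filter fun x =>
      (q : ℤ) ∣ (x.1 : ℤ) * n - x.2 * m).card := by
  refine Finset.card_le_card_of_injOn (fun x => (q * x.1 % m, q * x.2 % n)) ?_ ?_
  · rintro ⟨a, b⟩ hx
    simp only [sameBlockPairs, Finset.coe_filter, Finset.mem_product, mem_reducedResidues,
      Set.mem_ofPred_eq] at hx ⊢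
    obtain ⟨⟨⟨ha, ha'⟩, hb, hb'⟩, h⟩ := hx
    refine ⟨⟨⟨Nat.mod_lt _ (by omega), ?_⟩, Nat.mod_lt _ (by omega), ?_⟩, ?_⟩
    · rw [Nat.coprime_comm, Nat.Coprime, ← Nat.gcd_rec]
      exact hm.symm.mul_right ha'
    · rw [Nat.coprime_comm, Nat.Coprime, ← Nat.gcd_rec]
      exact hn.symm.mul_right hb'
    · have h1 := Nat.div_add_mod (q * a) m
      have h2 := Nat.div_add_mod (q * b) n
      rw [← h] at h2
      refine ⟨(a : ℤ) * n - b * m, ?_⟩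
      zify at h1 h2
      push_cast
      linear_combination (n : ℤ) * h1 - m * h2
  · have aux : ∀ {n a a' : ℕ}, q.Coprime n → a < n → a' < n → q * a % n = q * a' % n → a = a' := by
      intro n a a' h ha ha' e
      have := Nat.ModEq.cancel_left_of_coprime (by rwa [Nat.gcd_comm] : n.gcd q = 1) e
      rwa [Nat.ModEq, Nat.mod_eq_of_lt ha, Nat.mod_eq_of_lt ha'] at this
    rintro ⟨a, b⟩ hx ⟨a', b'⟩ hx' e
    simp only [sameBlockPairs, Finset.coe_filter, Finset.mem_product, mem_reducedResidues,
      Set.mem_ofPred_eq] at hx hx'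
    simp only [Prod.mk.injEq] at e ⊢
    exact ⟨aux hm hx.1.1.1 hx'.1.1.1 e.1, aux hn hx.1.2.1 hx'.1.2.1 e.2⟩

theorem isUnit_natCast_zmod_pow {p n : ℕ} (hn : p.Coprime n) (k : ℕ) : IsUnit (n : ZMod (p ^ k)) :=
  (ZMod.isUnit_iff_coprime n (p ^ k)).2 (hn.symm.pow_right k)

theorem card_coprime_Icc_neg_le {n : ℕ} (hn : 0 < n) :
    ((Finset.Icc (-(n : ℤ)) n).filter fun a => Int.gcd a n = 1).card ≤ 3 * n.totient := by
  have hsub : ((Finset.range 3).biUnion fun i => (Finset.Ico (i * n) (i * n + n)).filter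
      fun x => n.Coprime x).card ≤ 3 * n.totient := by
    refine Finset.card_biUnion_le.trans ?_
    simp only [Nat.filter_coprime_Ico_eq_totient]
    simp
  refine le_trans (Finset.card_le_card_of_injOn (fun a => (a + n).toNat) ?_ ?_) hsub
  · intro a ha
    simp only [Finset.coe_filter, Finset.mem_Icc, Set.mem_ofPred_eq] at ha
    obtain ⟨⟨h1, h2⟩, h3⟩ := ha
    obtain ⟨b, hb⟩ := Int.eq_ofNat_of_zero_le (show 0 ≤ a + n by omega)
    have hb' : b < n * 3 := by omega
    simp only [Finset.coe_biUnion, Finset.mem_coe, Finset.mem_range, Set.mem_iUnion,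
      Finset.mem_filter, Finset.mem_Ico]
    have e : (a + n).toNat = b := by omega
    rw [e]
    refine ⟨b / n, (Nat.div_lt_iff_lt_mul hn).2 (by omega), ⟨Nat.div_mul_le_self b n, ?_⟩, ?_⟩
    · have := Nat.lt_div_mul_add (a := b) hn
      omega
    · rw [Nat.coprime_comm, Nat.Coprime, ← Int.gcd_natCast_natCast, show (b : ℤ) = a + n by omega]
      simpa using h3
  · intro a ha b hb e
    simp only [Finset.coe_filter, Finset.mem_Icc, Set.mem_ofPred_eq] at ha hb e
    omega

section PadicSide

variable {p : ℕ} [Fact p.Prime]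

theorem toZModPow_eq_zero_iff (k : ℕ) (x : ℤ_[p]) :
    PadicInt.toZModPow k x = 0 ↔ ‖x‖ ≤ ((p : ℝ) ^ k)⁻¹ := by
  rw [← RingHom.mem_ker, PadicInt.ker_toZModPow, ← PadicInt.norm_le_pow_iff_mem_span_pow,
    zpow_neg, zpow_natCast]

theorem mem_padicE_iff {ψ : ℕ → ℝ} {n k : ℕ} (hn : p.Coprime n) (h : ψ n = ((p : ℝ) ^ k)⁻¹)
    (x : ℤ_[p]) : x ∈ padicE p ψ n ↔ ∃ a : ℤ, |a| ≤ n ∧ Int.gcd a n = 1 ∧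
      (n : ZMod (p ^ k)) * PadicInt.toZModPow k x = a := by
  have hnorm : ‖(n : ℤ_[p])‖ = 1 := PadicInt.norm_natCast_eq_one_iff.2 hn
  have hnorm' : ‖(n : ℚ_[p])‖ = 1 := by simpa using hnorm
  have hn0 : (n : ℚ_[p]) ≠ 0 := norm_ne_zero_iff.1 (by rw [hnorm']; exact one_ne_zero)
  refine exists_congr fun a => and_congr_right fun _ => and_congr_right fun _ => ?_
  have e : (n : ZMod (p ^ k)) * PadicInt.toZModPow k x = a ↔
      PadicInt.toZModPow (p := p) k (n * x - a) = 0 := by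
    rw [map_sub, map_mul, map_natCast, map_intCast, sub_eq_zero]
  rw [e, toZModPow_eq_zero_iff, h]
  have : ‖(n * x - a : ℤ_[p])‖ = ‖(x : ℚ_[p]) - a / n‖ := by
    rw [PadicInt.norm_def]
    push_cast
    rw [show (n : ℚ_[p]) * x - a = n * (x - a / n) by field_simp, norm_mul, hnorm', one_mul]
  rw [this]

theorem measurableSet_fiber_toZModPow [MeasurableSpace ℤ_[p]] [BorelSpace ℤ_[p]] (k : ℕ)
    (z : ZMod (p ^ k)) : MeasurableSet (PadicInt.toZModPow (p := p) k ⁻¹' {z}) := by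
  obtain ⟨y, rfl⟩ := ZMod.ringHom_surjective (PadicInt.toZModPow (p := p) k) z
  have : PadicInt.toZModPow (p := p) k ⁻¹' {PadicInt.toZModPow k y} =
      Metric.closedBall y ((p : ℝ) ^ k)⁻¹ := by
    ext x
    rw [Set.mem_preimage, Set.mem_singleton_iff, ← sub_eq_zero, ← map_sub, toZModPow_eq_zero_iff,
      Metric.mem_closedBall, dist_eq_norm]
  rw [this]
  exact Metric.isClosed_closedBall.measurableSet

variable [MeasurableSpace ℤ_[p]] [BorelSpace ℤ_[p]] (μ : Measure ℤ_[p]) [μ.IsAddHaarMeasure]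
  [IsProbabilityMeasure μ]

theorem measure_fiber_toZModPow (k : ℕ) (z : ZMod (p ^ k)) :
    μ (PadicInt.toZModPow (p := p) k ⁻¹' {z}) = ((p ^ k : ℕ) : ENNReal)⁻¹ := by
  have hp : 0 < p ^ k := pow_pos (Fact.out : p.Prime).pos k
  have hsurj := ZMod.ringHom_surjective (PadicInt.toZModPow (p := p) k)
  obtain ⟨y, rfl⟩ := hsurj z
  set H : AddSubgroup ℤ_[p] := (PadicInt.toZModPow (p := p) k).toAddMonoidHom.ker with hH
  have hHset : (H : Set ℤ_[p]) = PadicInt.toZModPow (p := p) k ⁻¹' {0} := rfl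
  have hindex : H.index = p ^ k := by
    rw [hH, AddSubgroup.index_ker, AddMonoidHom.range_eq_top.2 hsurj, AddSubgroup.card_top,
      Nat.card_zmod]
  have : H.FiniteIndex := ⟨by rw [hindex]; exact hp.ne'⟩
  have h1 := AddSubgroup.index_mul_measure H
    (by rw [hHset]; exact measurableSet_fiber_toZModPow k 0) μ
  rw [hindex, measure_univ, mul_comm] at h1
  have h2 : PadicInt.toZModPow (p := p) k ⁻¹' {PadicInt.toZModPow k y} =
      (fun x => x + -y) ⁻¹' (H : Set ℤ_[p]) := by
    ext x
    simp [hHset, ← sub_eq_add_neg, sub_eq_zero]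
  rw [h2, measure_preimage_add_right]
  exact ENNReal.eq_inv_of_mul_eq_one_left h1

theorem measure_singleton_padicInt (x : ℤ_[p]) : μ {x} = 0 := by
  have hlim : Tendsto (fun k : ℕ => ((p ^ k : ℕ) : ENNReal)⁻¹) atTop (nhds 0) := by
    refine ENNReal.tendsto_inv_nat_nhds_zero.comp ?_
    exact tendsto_pow_atTop_atTop_of_one_lt (Fact.out : p.Prime).one_lt
  refine le_antisymm (ge_of_tendsto' hlim fun k => ?_) zero_le
  rw [← measure_fiber_toZModPow μ k (PadicInt.toZModPow k x)]
  exact measure_mono (by simp)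

theorem measure_padicE_of_eq_zero {ψ : ℕ → ℝ} {n : ℕ} (h : ψ n = 0) : μ (padicE p ψ n) = 0 := by
  have hcount : (padicE p ψ n).Countable := by
    refine Set.Countable.mono ?_ ((Set.countable_range fun a : ℤ =>
      (a : ℚ_[p]) / (n : ℚ_[p])).preimage (Subtype.val_injective (p := fun x : ℚ_[p] => ‖x‖ ≤ 1)))
    rintro x ⟨a, -, -, hx⟩
    rw [h, norm_le_zero_iff, sub_eq_zero] at hx
    exact ⟨a, hx.symm⟩
  rw [← Set.biUnion_of_singleton (padicE p ψ n), measure_biUnion_null_iff hcount]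
  exact fun x _ => measure_singleton_padicInt μ x

theorem measure_padicE_le {ψ : ℕ → ℝ} {n k : ℕ} (hn : p.Coprime n) (h : ψ n = ((p : ℝ) ^ k)⁻¹) :
    μ (padicE p ψ n) ≤ 3 * (n.totient / (p ^ k : ℕ)) := by
  have hn0 : 0 < n := by
    rcases Nat.eq_zero_or_pos n with rfl | h0
    · exact absurd (Nat.coprime_zero_right p |>.1 hn) (Fact.out : p.Prime).one_lt.ne'
    · exact h0
  set u := (isUnit_natCast_zmod_pow hn k).unit with hu
  have hsub : padicE p ψ n ⊆ ⋃ a ∈ (Finset.Icc (-(n : ℤ)) n).filter fun a => Int.gcd a n = 1,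
      PadicInt.toZModPow (p := p) k ⁻¹' {((u⁻¹ : (ZMod (p ^ k))ˣ) : ZMod (p ^ k)) * (a : ZMod (p ^ k))} := by
    intro x hx
    obtain ⟨a, h1, h2, h3⟩ := (mem_padicE_iff hn h x).1 hx
    simp only [Set.mem_iUnion]
    refine ⟨a, Finset.mem_filter.2 ⟨Finset.mem_Icc.2 (abs_le.1 h1), h2⟩, ?_⟩
    rw [Set.mem_preimage, Set.mem_singleton_iff, ← h3, ← IsUnit.unit_spec (isUnit_natCast_zmod_pow hn k),
      ← hu, Units.inv_mul_cancel_left]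
  refine (measure_mono hsub).trans ((measure_biUnion_finset_le _ _).trans ?_)
  simp only [measure_fiber_toZModPow, Finset.sum_const, nsmul_eq_mul]
  rw [div_eq_mul_inv, ← mul_assoc]
  gcongr
  exact_mod_cast card_coprime_Icc_neg_le hn0

theorem le_measure_padicE_inter {ψ : ℕ → ℝ} {m n k l : ℕ} (hm : p.Coprime m) (hn : p.Coprime n)
    (hk : ψ m = ((p : ℝ) ^ k)⁻¹) (hl : ψ n = ((p : ℝ) ^ l)⁻¹) (hkl : k ≤ l) (hmk : m ≤ p ^ k)
    (hnl : n ≤ p ^ l) :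
    (((reducedResidues m ×ˢ reducedResidues n).filter fun x =>
      ((p ^ k : ℕ) : ℤ) ∣ (x.1 : ℤ) * n - x.2 * m).card : ENNReal) / (p ^ l : ℕ) ≤
      μ (padicE p ψ m ∩ padicE p ψ n) := by
  set P := (reducedResidues m ×ˢ reducedResidues n).filter fun x =>
      ((p ^ k : ℕ) : ℤ) ∣ (x.1 : ℤ) * n - x.2 * m with hP
  set u := (isUnit_natCast_zmod_pow hn l).unit with hu
  have hun : (u : ZMod (p ^ l)) = n := rfl
  set F : ℕ × ℕ → Set ℤ_[p] := fun x => PadicInt.toZModPow (p := p) l ⁻¹'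
    {((u⁻¹ : (ZMod (p ^ l))ˣ) : ZMod (p ^ l)) * (x.2 : ZMod (p ^ l))} with hF
  have hcong : ∀ {x : ℤ_[p]} {y}, x ∈ F y → (n : ZMod (p ^ l)) * PadicInt.toZModPow l x = y.2 := by
    intro x y hx
    rw [Set.mem_preimage, Set.mem_singleton_iff] at hx
    rw [hx, ← hun, Units.mul_inv_cancel_left]
  have hsub : ⋃ y ∈ P, F y ⊆ padicE p ψ m ∩ padicE p ψ n := by
    intro x hx
    simp only [Set.mem_iUnion] at hx
    obtain ⟨⟨a, b⟩, hy, hx⟩ := hx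
    obtain ⟨hab, hdvd⟩ := Finset.mem_filter.1 hy
    simp only [Finset.mem_product, mem_reducedResidues] at hab hdvd
    obtain ⟨⟨ha, ha'⟩, hb, hb'⟩ := hab
    have hc := hcong hx
    constructor
    · rw [mem_padicE_iff hm hk]
      refine ⟨a, by rw [Nat.abs_cast]; omega, by simpa [Nat.gcd_comm] using ha', ?_⟩
      have hc' := congrArg (ZMod.castHom (pow_dvd_pow p hkl) (ZMod (p ^ k))) hc
      simp only [map_mul, map_natCast] at hc'
      rw [show ZMod.castHom (pow_dvd_pow p hkl) (ZMod (p ^ k)) (PadicInt.toZModPow l x) =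
        PadicInt.toZModPow k x from PadicInt.cast_toZModPow k l hkl x] at hc'
      have hd := (ZMod.intCast_zmod_eq_zero_iff_dvd _ _).2 hdvd
      push_cast at hd
      refine (isUnit_natCast_zmod_pow hn k).mul_left_cancel ?_
      push_cast
      linear_combination (m : ZMod (p ^ k)) * hc' - hd
    · rw [mem_padicE_iff hn hl]
      exact ⟨b, by rw [Nat.abs_cast]; omega, by simpa [Nat.gcd_comm] using hb', by simpa using hc⟩
  have hdisj : (P : Set (ℕ × ℕ)).PairwiseDisjoint F := by
    rintro ⟨a, b⟩ hy ⟨a', b'⟩ hy' hne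
    refine Set.disjoint_left.2 fun x hx hx' => hne ?_
    obtain ⟨hab, hdvd⟩ := Finset.mem_filter.1 hy
    obtain ⟨hab', hdvd'⟩ := Finset.mem_filter.1 hy'
    simp only [Finset.mem_product, mem_reducedResidues] at hab hdvd hab' hdvd'
    have hbb : b = b' := by
      have := (hcong hx).symm.trans (hcong hx')
      rw [ZMod.natCast_eq_natCast_iff', Nat.mod_eq_of_lt (by omega), Nat.mod_eq_of_lt (by omega)] at this
      exact this
    subst hbb
    have haa : a = a' := by
      have h1 : ((p ^ k : ℕ) : ℤ) ∣ ((a : ℤ) - a') * n := by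
        have := dvd_sub hdvd hdvd'
        ring_nf at this ⊢
        exact this
      have h2 := (ZMod.intCast_zmod_eq_zero_iff_dvd _ _).2 h1
      push_cast at h2
      have h3 := (isUnit_natCast_zmod_pow hn k).mul_left_eq_zero.1 h2
      rw [sub_eq_zero, ZMod.natCast_eq_natCast_iff', Nat.mod_eq_of_lt (by omega),
        Nat.mod_eq_of_lt (by omega)] at h3
      exact h3
    rw [haa]
  refine le_trans (le_of_eq ?_) (measure_mono hsub)
  rw [measure_biUnion_finset hdisj fun y _ => measurableSet_fiber_toZModPow l _]
  simp only [hF, measure_fiber_toZModPow, Finset.sum_const, nsmul_eq_mul, div_eq_mul_inv]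

end PadicSide

theorem card_sameBlockPairs_comm (m n q : ℕ) :
    (sameBlockPairs m n q).card = (sameBlockPairs n m q).card := by
  refine Finset.card_equiv (Equiv.prodComm ℕ ℕ) fun y => ?_
  simp only [sameBlockPairs, Finset.mem_filter, Finset.mem_product, Equiv.prodComm_apply,
    Prod.fst_swap, Prod.snd_swap]
  exact and_congr and_comm eq_comm

/-- The weight `φ(n) / p ^ k(n)` of the denominators in `T`. -/
def blockWeight (p : ℕ) (T : Set ℕ) (k : ℕ → ℕ) : ℕ → ENNReal :=
  T.indicator fun n => (n.totient : ENNReal) / (p ^ k n : ℕ)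

/-- The points that are within `p ^ (-k(n))` of a reduced fraction with denominator `n`, for
infinitely many `n ∈ T`. -/
def blockLimsup (p : ℕ) (T : Set ℕ) (k : ℕ → ℕ) : Set ℝ :=
  {x | {n | n ∈ T ∧ ∃ a ∈ reducedResidues n, |x - a / n| < ((p : ℝ) ^ k n)⁻¹}.Infinite}

theorem tendsto_sum_blockWeight {p : ℕ} {T : Set ℕ} {k : ℕ → ℕ} (h0 : 0 ∉ T)
    (hdiv : ∑' n, blockWeight p T k n = ⊤) :
    Tendsto (fun N => ∑ n ∈ Finset.Icc 1 N, blockWeight p T k n) atTop (nhds ⊤) := by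
  have h := (tendsto_add_atTop_iff_nat 1).2 (ENNReal.tendsto_nat_tsum (blockWeight p T k))
  rw [hdiv] at h
  refine h.congr fun N => (Finset.sum_subset (fun n hn => ?_) fun n hn hn' => ?_).symm
  · simp only [Finset.mem_Icc, Finset.mem_range] at hn ⊢; omega
  · simp only [Finset.mem_Icc, Finset.mem_range] at hn hn'
    obtain rfl : n = 0 := by omega
    exact Set.indicator_of_notMem h0 _

theorem blockLimsup_ne_zero_of_quasiIndependent {p : ℕ} (hp : p.Prime) {T : Set ℕ} {k : ℕ → ℕ}
    (h0 : 0 ∉ T) (hdiv : ∑' n, blockWeight p T k n = ⊤) {C : ENNReal} (hC : C ≠ ⊤)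
    {P : ℕ → ℕ → ENNReal}
    (hP : ∀ m ∈ T, ∀ n ∈ T, ((sameBlockPairs m n (p ^ min (k m) (k n))).card : ENNReal) /
      (p ^ max (k m) (k n) : ℕ) ≤ P m n)
    (hqi : ∃ᶠ N in atTop, ∑ m ∈ Finset.Icc 1 N, ∑ n ∈ Finset.Icc 1 N, P m n ≤
      C * (∑ n ∈ Finset.Icc 1 N, blockWeight p T k n) ^ 2) :
    volume.restrict (Set.Ico 0 1) (blockLimsup p T k) ≠ 0 := by
  classical
  set f : ℕ → ℝ → ENNReal := fun n x => if n ∈ T then fractionBlockCount n (p ^ k n) x else 0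
    with hf
  have hpk : ∀ j, 0 < p ^ j := fun j => pow_pos hp.pos j
  have hfm : ∀ n, Measurable (f n) := fun n => by
    by_cases hn : n ∈ T
    · simpa [hf, hn] using measurable_fractionBlockCount n (p ^ k n)
    · simp [hf, hn]
  have hlint : ∀ n, ∫⁻ x in Set.Ico 0 1, f n x = blockWeight p T k n := fun n => by
    by_cases hn : n ∈ T
    · simp only [hf, hn, if_true, blockWeight, Set.indicator_of_mem]
      exact lintegral_fractionBlockCount n (hpk _)
    · simp [hf, hn, blockWeight]
  have hprod : ∀ m n, ∫⁻ x in Set.Ico 0 1, f m x * f n x ≤ P m n := fun m n => by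
    by_cases hm : m ∈ T
    swap; · simp [hf, hm]
    by_cases hn : n ∈ T
    swap; · simp [hf, hn]
    refine le_trans ?_ (hP m hm n hn)
    simp only [hf, hm, hn, if_true]
    rcases le_total (k m) (k n) with h | h
    · rw [min_eq_left h, max_eq_right h]
      exact lintegral_fractionBlockCount_mul_le m n (pow_dvd_pow p h) (hpk _)
    · rw [min_eq_right h, max_eq_left h]
      simp_rw [card_sameBlockPairs_comm m n, mul_comm (fractionBlockCount m _ _)]
      exact lintegral_fractionBlockCount_mul_le n m (pow_dvd_pow p h) (hpk _)
  have hfin : ∀ n, ∫⁻ x in Set.Ico 0 1, f n x ≠ ⊤ := fun n => by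
    rw [hlint, blockWeight]
    refine ne_top_of_le_ne_top ?_ (Set.indicator_le_self _ _ n)
    exact ENNReal.div_ne_top (ENNReal.natCast_ne_top _) (by exact_mod_cast (hpk _).ne')
  have hmain := measure_infinite_support_ne_zero hfm hfin
    (by simpa only [hlint] using tendsto_sum_blockWeight h0 hdiv) hC
    (hqi.mono fun N hN => by
      simp only [hlint]
      exact (Finset.sum_le_sum fun m _ => Finset.sum_le_sum fun n _ => hprod m n).trans hN)
  refine fun hzero => hmain (measure_mono_null (fun x hx => ?_) hzero)
  refine Set.Infinite.mono (fun n hn => ?_) hx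
  by_cases hnT : n ∈ T
  · simp only [hf, hnT, if_true, Set.mem_ofPred_eq] at hn
    refine ⟨hnT, ?_⟩
    simpa using exists_abs_sub_lt_of_fractionBlockCount_ne_zero (hpk _) hn
  · simp [hf, hnT] at hn

theorem blockLimsup_ne_zero_of_pow_le {p : ℕ} (hp : p.Prime) {T : Set ℕ} {k : ℕ → ℕ}
    (hk : ∀ n ∈ T, p ^ k n ≤ n) (hdiv : ∑' n, blockWeight p T k n = ⊤) :
    volume.restrict (Set.Ico 0 1) (blockLimsup p T k) ≠ 0 := by
  classical
  have h0 : 0 ∉ T := fun h => by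
    have := hk 0 h
    have := pow_pos hp.pos (k 0)
    omega
  obtain ⟨C, hC⟩ := exists_card_close_fractions_mul_le
  set w := blockWeight p T k with hw
  refine blockLimsup_ne_zero_of_quasiIndependent hp h0 hdiv (C := C + 1) (by simp)
    (P := fun m n => C * (w m * w n) + if m = n then w n else 0) ?_ ?_
  · intro m hm n hn
    set M := p ^ min (k m) (k n) with hM
    set L := p ^ max (k m) (k n) with hL
    have hML : M * L = p ^ k m * p ^ k n := by
      rw [hM, hL, ← pow_add, ← pow_add, min_add_max]
    have hM0 : 0 < M := pow_pos hp.pos _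
    have hL0 : 0 < L := pow_pos hp.pos _
    have h1 := hC m n M hM0
      ((Nat.pow_le_pow_right hp.pos (min_le_left _ _)).trans (hk m hm))
      ((Nat.pow_le_pow_right hp.pos (min_le_right _ _)).trans (hk n hn))
    have h2 : (sameBlockPairs m n M).card * M ≤
        C * (m.totient * n.totient) + if m = n then n.totient * M else 0 := by
      refine le_trans (Nat.mul_le_mul_right M (Finset.card_le_card fun y hy => ?_)) h1
      exact Finset.mem_filter.2 ⟨(Finset.mem_filter.1 hy).1, mul_lt_of_mem_sameBlockPairs hy⟩
    have h3 : ((sameBlockPairs m n M).card : ENNReal) * M ≤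
        C * (m.totient * n.totient) + if m = n then (n.totient * M : ENNReal) else 0 := by
      exact_mod_cast h2
    have hMne : (M : ENNReal) ≠ 0 := by exact_mod_cast hM0.ne'
    have hLne : (L : ENNReal) ≠ 0 := by exact_mod_cast hL0.ne'
    have ha : (p ^ k m : ℕ) ≠ 0 := (pow_pos hp.pos _).ne'
    have hb : (p ^ k n : ℕ) ≠ 0 := (pow_pos hp.pos _).ne'
    simp only [hw, blockWeight, Set.indicator_of_mem hm, Set.indicator_of_mem hn]
    calc ((sameBlockPairs m n M).card : ENNReal) / L
        = (sameBlockPairs m n M).card * M / (M * L : ℕ) := by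
          rw [mul_comm _ (M : ENNReal), Nat.cast_mul,
            ENNReal.mul_div_mul_left _ _ hMne (ENNReal.natCast_ne_top _)]
      _ ≤ (C * (m.totient * n.totient) + if m = n then (n.totient * M : ENNReal) else 0) /
            (M * L : ℕ) := by gcongr
      _ = _ := by
        rw [ENNReal.add_div]
        congr 1
        · rw [hML, Nat.cast_mul, mul_div_assoc, ENNReal.mul_div_mul_comm]
          · left; exact_mod_cast ha
          · left; simp
        · split_ifs with hmn
          · subst hmn
            rw [mul_comm, Nat.cast_mul, ENNReal.mul_div_mul_left _ _ hMne (ENNReal.natCast_ne_top _)]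
            rw [hL, max_self]
          · simp
  · refine Eventually.frequently ?_
    have h1 := (tendsto_sum_blockWeight h0 hdiv).eventually (Ioi_mem_nhds ENNReal.one_lt_top)
    filter_upwards [h1] with N hN
    set s := ∑ n ∈ Finset.Icc 1 N, blockWeight p T k n with hs
    have hs1 : s ≤ s ^ 2 := by
      rw [sq]
      exact le_mul_of_one_le_right' (le_of_lt hN)
    calc ∑ m ∈ Finset.Icc 1 N, ∑ n ∈ Finset.Icc 1 N, (C * (w m * w n) + if m = n then w n else 0)
        = C * s ^ 2 + s := by
          have hrow : ∀ m ∈ Finset.Icc 1 N, ∑ n ∈ Finset.Icc 1 N,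
              (C * (w m * w n) + if m = n then w n else 0) = C * (w m * s) + w m := by
            intro m hm
            rw [Finset.sum_add_distrib, ← Finset.mul_sum, ← Finset.mul_sum, Finset.sum_ite_eq,
              if_pos hm]
          rw [Finset.sum_congr rfl hrow, Finset.sum_add_distrib, ← Finset.mul_sum,
            ← Finset.sum_mul, sq]
      _ ≤ C * s ^ 2 + s ^ 2 := by gcongr
      _ = _ := by rw [add_mul, one_mul]

theorem blockLimsup_ne_zero_of_le_pow {p : ℕ} [Fact p.Prime] [MeasurableSpace ℤ_[p]]
    [BorelSpace ℤ_[p]] (μ : Measure ℤ_[p]) [μ.IsAddHaarMeasure] [IsProbabilityMeasure μ]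
    (hQIA : QIApHolds p μ) {T : Set ℕ} {k : ℕ → ℕ} (hT : ∀ n ∈ T, p.Coprime n)
    (hk : ∀ n ∈ T, n ≤ p ^ k n) (hdiv : ∑' n, blockWeight p T k n = ⊤) :
    volume.restrict (Set.Ico 0 1) (blockLimsup p T k) ≠ 0 := by
  have hp : p.Prime := Fact.out
  have h0 : 0 ∉ T := fun h => hp.one_lt.ne' ((Nat.coprime_zero_right p).1 (hT 0 h))
  set ψ : ℕ → ℝ := T.indicator fun n => ((p : ℝ) ^ k n)⁻¹ with hψ
  have hψT : ∀ n ∈ T, ψ n = ((p : ℝ) ^ k n)⁻¹ := fun n hn => Set.indicator_of_mem hn _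
  set w := blockWeight p T k with hw
  have hinter : ∀ m ∈ T, ∀ n ∈ T, ((sameBlockPairs m n (p ^ min (k m) (k n))).card : ENNReal) /
      (p ^ max (k m) (k n) : ℕ) ≤ μ (padicE p ψ m ∩ padicE p ψ n) := by
    have aux : ∀ m ∈ T, ∀ n ∈ T, k m ≤ k n →
        ((sameBlockPairs m n (p ^ min (k m) (k n))).card : ENNReal) /
        (p ^ max (k m) (k n) : ℕ) ≤ μ (padicE p ψ m ∩ padicE p ψ n) := by
      intro m hm n hn h
      rw [min_eq_left h, max_eq_right h]
      refine le_trans ?_ (le_measure_padicE_inter μ (hT m hm) (hT n hn) (hψT m hm) (hψT n hn) h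
        (hk m hm) (hk n hn))
      refine ENNReal.div_le_div_right (Nat.cast_le.2 ?_) _
      exact card_sameBlockPairs_le ((hT m hm).pow_left _) ((hT n hn).pow_left _)
    intro m hm n hn
    rcases le_total (k m) (k n) with h | h
    · exact aux m hm n hn h
    · have := aux n hn m hm h
      rwa [min_comm, max_comm, Set.inter_comm, card_sameBlockPairs_comm] at this
  have hle : ∀ n, μ (padicE p ψ n) ≤ 3 * w n := fun n => by
    by_cases hn : n ∈ T
    · rw [hw, blockWeight, Set.indicator_of_mem hn]
      exact measure_padicE_le μ (hT n hn) (hψT n hn)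
    · rw [measure_padicE_of_eq_zero μ (show ψ n = 0 from Set.indicator_of_notMem hn _)]
      exact zero_le
  have hge : ∀ n, w n ≤ μ (padicE p ψ n) := fun n => by
    by_cases hn : n ∈ T
    · have h1 := hinter n hn n hn
      rw [Set.inter_self, max_self] at h1
      rw [hw, blockWeight, Set.indicator_of_mem hn]
      refine le_trans ?_ h1
      gcongr
      rw [← card_reducedResidues]
      refine Finset.card_le_card_of_injOn (fun a => (a, a)) (fun a ha => ?_)
        fun a _ b _ e => (Prod.mk.inj e).1
      exact Finset.mem_filter.2 ⟨Finset.mem_product.2 ⟨ha, ha⟩, rfl⟩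
    · rw [hw, blockWeight, Set.indicator_of_notMem hn]
      exact zero_le
  have hlim := hQIA ψ (fun n => Set.indicator_nonneg (fun _ _ => by positivity) n)
    (top_le_iff.1 (hdiv ▸ ENNReal.tsum_le_tsum hge))
  obtain ⟨c, hc0, hc⟩ := exists_between hlim
  have hctop : c ≠ ⊤ := (hc.trans_le le_top).ne
  refine blockLimsup_ne_zero_of_quasiIndependent hp h0 hdiv (C := 9 / c)
    (ENNReal.div_ne_top (by simp) hc0.ne') hinter ?_
  refine (frequently_lt_of_lt_limsup (by isBoundedDefault) hc).mono fun N hN => ?_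
  have h1 := ENNReal.mul_le_of_le_div hN.le
  calc _ ≤ (∑ n ∈ Finset.Icc 1 N, μ (padicE p ψ n)) ^ 2 / c := by
        rw [ENNReal.le_div_iff_mul_le (Or.inl hc0.ne') (Or.inl hctop), mul_comm]
        exact h1
    _ ≤ (∑ n ∈ Finset.Icc 1 N, 3 * w n) ^ 2 / c := by
        gcongr with n
        exact hle n
    _ = _ := by
        rw [← Finset.mul_sum, mul_pow, ENNReal.div_eq_inv_mul, ENNReal.div_eq_inv_mul, mul_assoc]
        norm_num [hw]

theorem blockLimsup_ne_zero {p : ℕ} [Fact p.Prime] [MeasurableSpace ℤ_[p]]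
    [BorelSpace ℤ_[p]] (μ : Measure ℤ_[p]) [μ.IsAddHaarMeasure] [IsProbabilityMeasure μ]
    (hQIA : QIApHolds p μ) {T : Set ℕ} {k : ℕ → ℕ} (hT : ∀ n ∈ T, p.Coprime n)
    (hdiv : ∑' n, blockWeight p T k n = ⊤) :
    volume.restrict (Set.Ico 0 1) (blockLimsup p T k) ≠ 0 := by
  have hp : p.Prime := Fact.out
  set T₁ := {n ∈ T | n ≤ p ^ k n} with hT₁
  set T₂ := {n ∈ T | p ^ k n ≤ n} with hT₂
  have hsum : ∑' n, blockWeight p T₁ k n + ∑' n, blockWeight p T₂ k n = ⊤ := by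
    rw [← ENNReal.tsum_add, ← top_le_iff, ← hdiv]
    refine ENNReal.tsum_le_tsum fun n => ?_
    by_cases hn : n ∈ T
    · rcases le_total n (p ^ k n) with h | h
      · refine le_trans ?_ le_self_add
        rw [blockWeight, blockWeight, Set.indicator_of_mem hn, Set.indicator_of_mem (show n ∈ T₁ from ⟨hn, h⟩)]
      · refine le_trans ?_ le_add_self
        rw [blockWeight, blockWeight, Set.indicator_of_mem hn, Set.indicator_of_mem (show n ∈ T₂ from ⟨hn, h⟩)]
    · rw [blockWeight, Set.indicator_of_notMem hn]
      exact zero_le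
  have hmono : ∀ T' : Set ℕ, T' ⊆ T → volume.restrict (Set.Ico 0 1) (blockLimsup p T' k) ≠ 0 →
      volume.restrict (Set.Ico 0 1) (blockLimsup p T k) ≠ 0 := fun _ hsub h hz =>
    h (measure_mono_null (fun x hx => Set.Infinite.mono (fun n => And.imp_left (@hsub n)) hx) hz)
  rcases ENNReal.add_eq_top.1 hsum with h | h
  · exact hmono _ (fun n hn => hn.1)
      (blockLimsup_ne_zero_of_le_pow μ hQIA (fun n hn => hT n hn.1) (fun n hn => hn.2) h)
  · exact hmono _ (fun n hn => hn.1) (blockLimsup_ne_zero_of_pow_le hp (fun n hn => hn.2) h)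

theorem volume_circleA_le (ψ : ℕ → ℝ) (n : ℕ) :
    volume (circleA ψ n) ≤ n.totient * ENNReal.ofReal (2 * ψ n) := by
  have hsub : circleA ψ n ⊆ ⋃ a ∈ (Finset.Ico 1 (1 + n)).filter fun a => n.Coprime a,
      Metric.closedBall (((a : ℝ) / (n : ℝ) : ℝ) : UnitAddCircle) (ψ n) := by
    rintro x ⟨a, h1, h2, h3, h4⟩
    simp only [Set.mem_iUnion]
    refine ⟨a, Finset.mem_filter.2 ⟨Finset.mem_Ico.2 ⟨h1, by omega⟩, Nat.Coprime.symm h3⟩, ?_⟩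
    rwa [Metric.mem_closedBall, dist_eq_norm]
  refine (measure_mono hsub).trans ((measure_biUnion_finset_le _ _).trans ?_)
  rw [add_comm 1 n, ← Nat.filter_coprime_Ico_eq_totient n 1, ← nsmul_eq_mul, add_comm 1 n]
  refine Finset.sum_le_card_nsmul _ _ _ fun a _ => ?_
  rw [AddCircle.volume_closedBall]
  exact ENNReal.ofReal_le_ofReal (min_le_right _ _)

theorem exists_tsum_pow_mul_eq_top {p : ℕ} (hp : p.Prime) {F : ℕ → ENNReal} {N : ℕ}
    (hF : ∀ n, F n ≠ 0 → ¬ p ^ (N + 1) ∣ n) (hdiv : ∑' n, F n = ⊤) :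
    ∃ i, ∑' n, {n | p.Coprime n}.indicator (fun n => F (p ^ i * n)) n = ⊤ := by
  classical
  set G : ℕ → ℕ → ENNReal := fun i n => if p ^ i ∣ n ∧ p.Coprime (n / p ^ i) then F n else 0
    with hG
  have hpi : ∀ i, 0 < p ^ i := fun i => pow_pos hp.pos i
  have hle : ∀ n, F n ≤ ∑ i ∈ Finset.range (N + 1), G i n := by
    intro n
    by_cases hn : F n = 0
    · rw [hn]; exact zero_le
    have hnd := hF n hn
    have hn0 : n ≠ 0 := by rintro rfl; exact hnd (dvd_zero _)
    obtain ⟨i, m, hm, rfl⟩ := Nat.exists_eq_pow_mul_and_not_dvd hn0 p hp.ne_one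
    have hi : i < N + 1 := by
      by_contra hcon
      exact hnd ((pow_dvd_pow p (not_lt.1 hcon)).mul_right m)
    have hGi : F (p ^ i * m) = G i (p ^ i * m) := by
      simp [hG, Nat.mul_div_cancel_left _ (hpi i), (Nat.Prime.coprime_iff_not_dvd hp).2 hm]
    rw [hGi]
    exact Finset.single_le_sum (f := fun i' => G i' (p ^ i * m)) (fun _ _ => zero_le)
      (Finset.mem_range.2 hi)
  have htsum : ∀ i, ∑' n, G i n = ∑' n, {n | p.Coprime n}.indicator (fun n => F (p ^ i * n)) n := by
    intro i
    have hinj : Function.Injective fun n => p ^ i * n := fun a b h =>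
      Nat.eq_of_mul_eq_mul_left (hpi i) h
    rw [← hinj.tsum_eq (f := G i)]
    · refine tsum_congr fun n => ?_
      simp [hG, Set.indicator_apply, Nat.mul_div_cancel_left _ (hpi i)]
    · intro n hn
      obtain ⟨⟨m, rfl⟩, -⟩ := (ite_ne_right_iff.1 hn).1
      exact ⟨m, rfl⟩
  have htop : ∑ i ∈ Finset.range (N + 1), ∑' n, G i n = ⊤ := by
    rw [← Summable.tsum_finsetSum fun _ _ => ENNReal.summable, ← top_le_iff, ← hdiv]
    exact ENNReal.tsum_le_tsum hle
  obtain ⟨i, -, hi⟩ := ENNReal.sum_eq_top.1 htop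
  exact ⟨i, htsum i ▸ hi⟩

theorem norm_unitAddCircle_coe_le (x : ℝ) : ‖(x : UnitAddCircle)‖ ≤ |x| := by
  rw [UnitAddCircle.norm_eq]
  simpa using round_le x 0

theorem volume_preimage_coe_unitAddCircle_eq_zero {W : Set UnitAddCircle} (hW : volume W = 0) :
    volume ((fun x : ℝ => (x : UnitAddCircle)) ⁻¹' W) = 0 := by
  rw [← Set.inter_univ (_ ⁻¹' W), ← iUnion_Ioc_intCast ℝ, Set.inter_iUnion, measure_iUnion_null_iff]
  intro t
  have h := (UnitAddCircle.measurePreserving_mk t).quasiMeasurePreserving.preimage_null hW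
  exact le_antisymm ((Measure.le_restrict_apply _ _).trans h.le) zero_le

/-- If the reduced fractions with denominators `n ∈ T` approximate a set of positive measure, then
the reduced fractions with denominators `p ^ i * n` approximate almost every point. -/
theorem ae_mem_addWellApproximable {p : ℕ} (hp : p.Prime) {T : Set ℕ} (hT : ∀ n ∈ T, p.Coprime n)
    {k : ℕ → ℕ} (hB : volume.restrict (Set.Ico 0 1) (blockLimsup p T k) ≠ 0) (i : ℕ) {δ : ℕ → ℝ}
    (hδ : Tendsto δ atTop (nhds 0))
    (hδT : ∀ n ∈ T, ((p : ℝ) ^ k n)⁻¹ / (p ^ i : ℕ) ≤ δ (p ^ i * n)) :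
    ∀ᵐ x : UnitAddCircle, x ∈ addWellApproximable UnitAddCircle δ := by
  refine (AddCircle.addWellApproximable_ae_empty_or_univ δ hδ).resolve_left fun hempty => hB ?_
  set W := addWellApproximable UnitAddCircle δ with hW
  have hW0 : volume W = 0 := by
    have := ae_iff.1 hempty
    simpa using this
  set q := p ^ i with hq
  have hq0 : 0 < q := pow_pos hp.pos i
  have hq0' : (0 : ℝ) < q := by exact_mod_cast hq0
  have hnull : ∀ j : ℕ, volume {x : ℝ | (((x + j) / q : ℝ) : UnitAddCircle) ∈ W} = 0 := by
    intro j
    have h1 := volume_preimage_coe_unitAddCircle_eq_zero hW0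
    have h2 : volume ((fun x : ℝ => x * (q : ℝ)⁻¹) ⁻¹' ((fun x : ℝ => (x : UnitAddCircle)) ⁻¹' W)) = 0 := by
      rw [Real.volume_preimage_mul_right (inv_ne_zero hq0'.ne'), h1, mul_zero]
    rw [← measure_preimage_add_right volume (j : ℝ)] at h2
    exact h2
  have hsub : blockLimsup p T k ⊆ ⋃ j : ℕ, {x : ℝ | (((x + j) / q : ℝ) : UnitAddCircle) ∈ W} := by
    intro x hx
    set I : ℕ → Set ℕ := fun j => {n | n ∈ T ∧ ∃ a ∈ reducedResidues n,
      |x - a / n| < ((p : ℝ) ^ k n)⁻¹ ∧ q.Coprime (a + j * n) ∧ a + j * n < q * n} with hI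
    have hcover : {n | n ∈ T ∧ ∃ a ∈ reducedResidues n, |x - a / n| < ((p : ℝ) ^ k n)⁻¹} ⊆
        I 0 ∪ I 1 := by
      rintro n ⟨hn, a, ha, hax⟩
      have han := (mem_reducedResidues.1 ha).1
      have hle : n ≤ q * n := Nat.le_mul_of_pos_left n hq0
      by_cases hqa : q.Coprime a
      · exact Or.inl ⟨hn, a, ha, hax, by simpa using hqa, by omega⟩
      · have hi : i ≠ 0 := by rintro rfl; simp [hq] at hqa
        have hpa : p ∣ a := by
          by_contra h
          exact hqa (((Nat.Prime.coprime_iff_not_dvd hp).2 h).pow_left i)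
        have hpq : p ≤ q := Nat.le_self_pow hi p
        have h2q : 2 * n ≤ q * n := Nat.mul_le_mul_right n (hp.two_le.trans hpq)
        refine Or.inr ⟨hn, a, ha, hax, ?_, by omega⟩
        refine ((Nat.Prime.coprime_iff_not_dvd hp).2 fun h => ?_).pow_left i
        rw [one_mul] at h
        exact (Nat.Prime.coprime_iff_not_dvd hp).1 (hT n hn) ((Nat.dvd_add_right hpa).1 h)
    have hmem : ∀ j, (I j).Infinite → (((x + j) / q : ℝ) : UnitAddCircle) ∈ W := by
      intro j hj
      rw [hW, UnitAddCircle.mem_addWellApproximable_iff]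
      have hinj : Function.Injective fun n => q * n := fun a b h =>
        Nat.eq_of_mul_eq_mul_left hq0 h
      refine (hj.image hinj.injOn).mono ?_
      rintro _ ⟨n, ⟨hn, a, ha, hax, hcop, hlt⟩, rfl⟩
      obtain ⟨han, hcan⟩ := mem_reducedResidues.1 ha
      have hn0 : (0 : ℝ) < n := by exact_mod_cast (by omega : 0 < n)
      refine ⟨a + j * n, hlt, ?_, ?_⟩
      · refine Nat.Coprime.mul_right hcop.symm ?_
        rw [Nat.coprime_add_mul_right_left]
        exact hcan.symm
      · rw [← AddCircle.coe_sub]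
        refine (norm_unitAddCircle_coe_le _).trans_lt (lt_of_lt_of_le ?_ (hδT n hn))
        have e : (x + j) / q - ((a + j * n : ℕ) : ℝ) / ((q * n : ℕ) : ℝ) = (x - a / n) / q := by
          push_cast
          field_simp
          ring
        rw [e, abs_div, abs_of_pos hq0']
        gcongr
    rcases Set.infinite_union.1 (hx.mono hcover) with h | h
    · exact Set.mem_iUnion.2 ⟨0, hmem 0 h⟩
    · exact Set.mem_iUnion.2 ⟨1, hmem 1 h⟩
  exact le_antisymm ((Measure.restrict_apply_le _ _).trans
    (measure_mono_null hsub (measure_iUnion_null hnull)).le) zero_le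

theorem addWellApproximable_subset_circleW {ψ δ : ℕ → ℝ} (h : ∀ n, 0 < δ n → δ n ≤ ψ n) :
    addWellApproximable UnitAddCircle δ ⊆ circleW ψ := by
  intro x hx
  rw [UnitAddCircle.mem_addWellApproximable_iff] at hx
  refine hx.mono ?_
  rintro n ⟨m, hmn, hgcd, hlt⟩
  have hle := hlt.le.trans (h n ((norm_nonneg _).trans_lt hlt))
  rcases Nat.eq_zero_or_pos m with rfl | hm
  · obtain rfl : n = 1 := by simpa using hgcd
    refine ⟨1, le_rfl, le_rfl, by simp, ?_⟩
    have h1 : ((1 : ℝ) : UnitAddCircle) = 0 := AddCircle.coe_period 1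
    simpa [h1] using hle
  · exact ⟨m, hm, hmn.le, hgcd, hle⟩

theorem exists_inv_pow_lt_le {p : ℕ} (hp : p.Prime) {x : ℝ} (hx : 0 < x) (hx1 : x ≤ 1) :
    ∃ k : ℕ, ((p : ℝ) ^ k)⁻¹ < x ∧ x ≤ p * ((p : ℝ) ^ k)⁻¹ := by
  have hp1 : (1 : ℝ) < p := by exact_mod_cast hp.one_lt
  have hp0 : (0 : ℝ) < p := by linarith
  obtain ⟨n, h1, h2⟩ := exists_nat_pow_near_of_lt_one hx hx1 (inv_pos.2 hp0) (inv_lt_one_of_one_lt₀ hp1)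
  refine ⟨n + 1, by rwa [← inv_pow], ?_⟩
  rw [← inv_pow, pow_succ, mul_comm, mul_assoc, inv_mul_cancel₀ hp0.ne', mul_one]
  exact h2

theorem totient_pow_mul_le {p n : ℕ} (hn : p.Coprime n) (i : ℕ) :
    (p ^ i * n).totient ≤ p ^ i * n.totient := by
  rw [Nat.totient_mul (hn.pow_left i)]
  exact Nat.mul_le_mul_right _ (Nat.totient_le _)

theorem volume_circleA_pow_mul_le {p n : ℕ} (hp : p.Prime) (hn : p.Coprime n) (i k : ℕ) (ψ : ℕ → ℝ)
    (h : min (ψ (p ^ i * n)) (n.totient : ℝ)⁻¹ ≤ p * ((p : ℝ) ^ k)⁻¹) :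
    volume (circleA ψ (p ^ i * n)) ≤ (2 * p ^ (i + 1) : ℕ) * ((n.totient : ENNReal) / (p ^ k : ℕ)) := by
  have hn0 : 0 < n := by
    rcases Nat.eq_zero_or_pos n with rfl | h0
    · exact absurd ((Nat.coprime_zero_right p).1 hn) hp.one_lt.ne'
    · exact h0
  have hφ : (0 : ℝ) < n.totient := by exact_mod_cast Nat.totient_pos.2 hn0
  have hp0 : (0 : ℝ) < p := by exact_mod_cast hp.pos
  have hpi : (1 : ℝ) ≤ (p : ℝ) ^ i := one_le_pow₀ (by exact_mod_cast hp.one_le)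
  have hR : ((2 * p ^ (i + 1) : ℕ) : ENNReal) * ((n.totient : ENNReal) / (p ^ k : ℕ)) =
      ENNReal.ofReal (2 * p ^ i * n.totient * (p * ((p : ℝ) ^ k)⁻¹)) := by
    rw [← ENNReal.ofReal_natCast, ← ENNReal.ofReal_natCast, ← ENNReal.ofReal_natCast,
      ← ENNReal.ofReal_div_of_pos (by exact_mod_cast pow_pos hp.pos k),
      ← ENNReal.ofReal_mul (Nat.cast_nonneg _)]
    congr 1
    push_cast
    ring
  rw [hR]
  rcases min_le_iff.1 h with h | h
  · refine (volume_circleA_le ψ _).trans ?_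
    rw [← ENNReal.ofReal_natCast, ← ENNReal.ofReal_mul (Nat.cast_nonneg _)]
    refine ENNReal.ofReal_le_ofReal ?_
    have h1 : ((p ^ i * n).totient : ℝ) ≤ p ^ i * n.totient := by
      exact_mod_cast totient_pow_mul_le hn i
    calc ((p ^ i * n).totient : ℝ) * (2 * ψ (p ^ i * n))
        ≤ (p ^ i * n.totient) * (2 * (p * ((p : ℝ) ^ k)⁻¹)) :=
          mul_le_mul_of_nonneg h1 (by linarith) (Nat.cast_nonneg _) (by positivity)
      _ = _ := by ring
  · refine (measure_mono (Set.subset_univ _)).trans ?_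
    rw [UnitAddCircle.measure_univ, ← ENNReal.ofReal_one]
    refine ENNReal.ofReal_le_ofReal ?_
    calc (1 : ℝ) ≤ 2 * p ^ i * 1 := by linarith
      _ = 2 * p ^ i * (n.totient * (n.totient : ℝ)⁻¹) := by rw [mul_inv_cancel₀ hφ.ne']
      _ ≤ 2 * p ^ i * (n.totient * (p * ((p : ℝ) ^ k)⁻¹)) := by gcongr
      _ = _ := by ring

/-- **Theorem 1 (Haynes).** Fix a prime `p` and suppose `(QIA_p)` holds.  If `ψ` is a
non-negative function supported on a set `S ⊆ ℕ` such that `p^(N+1)` divides no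
member of `S`, and the sum of the measures of the sets `A_n(ψ)` diverges, then
`W_∞(ψ)` has full Lebesgue measure. -/
theorem stmt0 (p : ℕ) [Fact p.Prime] [MeasurableSpace ℤ_[p]] [BorelSpace ℤ_[p]]
    (μ : Measure ℤ_[p]) [μ.IsAddHaarMeasure] [IsProbabilityMeasure μ]
    (hQIA : QIApHolds p μ)
    (S : Set ℕ) (hS : ∃ N : ℕ, ∀ n ∈ S, ¬ p ^ (N + 1) ∣ n)
    (ψ : ℕ → ℝ) (hψ : ∀ n, 0 ≤ ψ n) (hsupp : ∀ n, n ∉ S → ψ n = 0)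
    (hdiv : ∑' n : ℕ, volume (circleA ψ n) = ⊤) :
    volume (circleW ψ) = 1 := by
  have hp : p.Prime := Fact.out
  obtain ⟨N, hN⟩ := hS
  have hzero : ∀ n, ψ n = 0 → volume (circleA ψ n) = 0 := fun n hn => by
    have := volume_circleA_le ψ n
    rwa [hn, mul_zero, ENNReal.ofReal_zero, mul_zero, nonpos_iff_eq_zero] at this
  obtain ⟨i, hi⟩ := exists_tsum_pow_mul_eq_top hp (N := N) (fun n hn => hN n <| by
    by_contra h
    exact hn (hzero n (hsupp n h))) hdiv
  set T : Set ℕ := {n | p.Coprime n ∧ 0 < ψ (p ^ i * n)} with hT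
  have hφ : ∀ n ∈ T, (1 : ℝ) ≤ n.totient := fun n hn => by
    have : n ≠ 0 := by
      rintro rfl
      exact hp.one_lt.ne' ((Nat.coprime_zero_right p).1 hn.1)
    exact_mod_cast Nat.totient_pos.2 (Nat.pos_of_ne_zero this)
  have hk : ∀ n, ∃ k : ℕ, n ∈ T → ((p : ℝ) ^ k)⁻¹ < min (ψ (p ^ i * n)) (n.totient : ℝ)⁻¹ ∧
      min (ψ (p ^ i * n)) (n.totient : ℝ)⁻¹ ≤ p * ((p : ℝ) ^ k)⁻¹ := fun n => by
    by_cases hn : n ∈ T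
    · have h1 := hφ n hn
      obtain ⟨k, hk⟩ := exists_inv_pow_lt_le hp (x := min (ψ (p ^ i * n)) (n.totient : ℝ)⁻¹)
        (lt_min hn.2 (by positivity)) ((min_le_right _ _).trans (inv_le_one_of_one_le₀ h1))
      exact ⟨k, fun _ => hk⟩
    · exact ⟨0, fun h => absurd h hn⟩
  choose k hk using hk
  have hweight : ∑' n, blockWeight p T k n = ⊤ := by
    have h1 : ∑' n, {n | p.Coprime n}.indicator (fun n => volume (circleA ψ (p ^ i * n))) n ≤
        (2 * p ^ (i + 1) : ℕ) * ∑' n, blockWeight p T k n := by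
      rw [← ENNReal.tsum_mul_left]
      refine ENNReal.tsum_le_tsum fun n => ?_
      refine Set.indicator_apply_le' (fun hn => ?_) fun _ => zero_le
      rcases (hψ (p ^ i * n)).eq_or_lt with h | h
      · rw [hzero _ h.symm]
        exact zero_le
      · have hnT : n ∈ T := ⟨hn, h⟩
        rw [blockWeight, Set.indicator_of_mem hnT]
        exact volume_circleA_pow_mul_le hp hn i (k n) ψ (hk n hnT).2
    rw [hi, top_le_iff] at h1
    by_contra hne
    exact ENNReal.mul_ne_top (ENNReal.natCast_ne_top _) hne h1
  set q := p ^ i with hq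
  have hq0 : 0 < q := pow_pos hp.pos i
  have hq1 : (1 : ℝ) ≤ q := by exact_mod_cast hq0
  set D : Set ℕ := (fun n => q * n) '' T with hD
  set δ : ℕ → ℝ := D.indicator fun m => ((p : ℝ) ^ k (m / q))⁻¹ / q with hδ
  have hδq : ∀ n ∈ T, δ (q * n) = ((p : ℝ) ^ k n)⁻¹ / q := fun n hn => by
    rw [hδ, Set.indicator_of_mem (show q * n ∈ D from ⟨n, hn, rfl⟩), Nat.mul_div_cancel_left _ hq0]
  have hδ0 : ∀ m, m ∉ D → δ m = 0 := fun m hm => Set.indicator_of_notMem hm _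
  have hδle : ∀ n ∈ T, δ (q * n) ≤ ((p : ℝ) ^ k n)⁻¹ := fun n hn => by
    rw [hδq n hn]
    exact div_le_self (by positivity) hq1
  have hδnonneg : ∀ m, 0 ≤ δ m := fun m => Set.indicator_nonneg (fun _ _ => by positivity) m
  have hδlim : Tendsto δ atTop (nhds 0) := by
    have hlim : Tendsto (fun m : ℕ => (q : ℝ) * (m.totient : ℝ)⁻¹) atTop (nhds 0) := by
      simpa using (tendsto_inv_atTop_zero.comp tendsto_totient_atTop).const_mul (q : ℝ)
    refine squeeze_zero hδnonneg (fun m => ?_) hlim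
    by_cases hm : m ∈ D
    · obtain ⟨n, hn, rfl⟩ := hm
      refine (hδle n hn).trans ((hk n hn).1.le.trans ((min_le_right _ _).trans ?_))
      have h1 := hφ n hn
      have h2 : ((q * n).totient : ℝ) ≤ q * n.totient := by
        exact_mod_cast totient_pow_mul_le hn.1 i
      have h3 : (0 : ℝ) < (q * n).totient := by
        have : n ≠ 0 := by rintro rfl; simp at h1; linarith
        exact_mod_cast Nat.totient_pos.2 (Nat.mul_pos hq0 (Nat.pos_of_ne_zero this))
      rw [← div_eq_mul_inv, le_div_iff₀ h3, inv_mul_le_iff₀ (by linarith)]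
      linarith
    · rw [hδ0 m hm]
      positivity
  have hsub : addWellApproximable UnitAddCircle δ ⊆ circleW ψ := by
    refine addWellApproximable_subset_circleW fun m hm => ?_
    by_cases hmD : m ∈ D
    · obtain ⟨n, hn, rfl⟩ := hmD
      exact (hδle n hn).trans ((hk n hn).1.le.trans (min_le_left _ _))
    · exact absurd (hδ0 m hmD) hm.ne'
  have hae : ∀ᵐ x : UnitAddCircle, x ∈ circleW ψ :=
    (ae_mem_addWellApproximable hp (fun n hn => hn.1)
      (blockLimsup_ne_zero μ hQIA (fun n hn => hn.1) hweight) i hδlim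
      fun n hn => (hδq n hn).ge).mono fun x hx => hsub hx
  have huniv : circleW ψ =ᵐ[volume] Set.univ := eventuallyEq_univ.2 hae
  rw [measure_congr huniv, UnitAddCircle.measure_univ]
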